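/- Let N(x) denote the number of positive integers n ≤ x such that n = a^2 + ab + b^2 for some integers a, b. Then N(x)·√(log x)/x → 2^{-1/2}·3^{-1/4}·∏_{p prime, p ≡ 2 (mod 3)} (1 - p^{-2})^{-1/2} as x → ∞. -/

import Mathlib

open Filter Real
open MeasureTheory Topology
open ArithmeticFunction (vonMangoldt)

lemma sinc_sq_le (x : ℝ) : sinc x ^ 2 ≤ 2 * (1 + x ^ 2)⁻¹ := by
  have h1 : sinc x ^ 2 ≤ 1 := by
    have := abs_sinc_le_one x
    rw [← sq_abs]; exact pow_le_one₀ (abs_nonneg _) this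
  have h2 : x ^ 2 * sinc x ^ 2 ≤ 1 := by
    rcases eq_or_ne x 0 with rfl | hx
    · simp
    · rw [sinc_of_ne_zero hx, div_pow, mul_div_cancel₀ _ (pow_ne_zero 2 hx)]
      exact sin_sq_le_one x
  rw [← div_eq_mul_inv, le_div_iff₀ (by positivity)]
  linarith

lemma integrable_sinc_sq : Integrable (fun x => sinc x ^ 2) := by
  refine (integrable_inv_one_add_sq.const_mul 2).mono'
    (continuous_sinc.pow 2).aestronglyMeasurable (Eventually.of_forall fun x => ?_)
  rw [norm_of_nonneg (sq_nonneg _)]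
  exact sinc_sq_le x

lemma integral_sinc_sq_pos : 0 < ∫ x, sinc x ^ 2 := by
  refine integral_pos_of_integrable_nonneg_nonzero (x := 0) (continuous_sinc.pow 2) integrable_sinc_sq
    (fun x => sq_nonneg _) (by simp)

lemma integral_tent_mul_cos {l : ℝ} (hl : 0 < l) {u : ℝ} (hu : u ≠ 0) :
    ∫ t in (0 : ℝ)..l, (1 - t / l) * cos (2 * t * u) = l * sinc (l * u) ^ 2 / 2 := by
  have hd : ∀ t ∈ Set.uIcc 0 l, HasDerivAt
      (fun t => (1 - t / l) * sin (2 * t * u) / (2 * u) - cos (2 * t * u) / (4 * l * u ^ 2))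
      ((1 - t / l) * cos (2 * t * u)) t := by
    intro t _
    have h0 : HasDerivAt (fun t : ℝ => 2 * t * u) (2 * u) t := by
      simpa using ((hasDerivAt_id t).const_mul 2).mul_const u
    have h1 : HasDerivAt (fun t : ℝ => 1 - t / l) (-(1 / l)) t := by
      simpa using ((hasDerivAt_id t).div_const l).const_sub 1
    refine (((h1.mul h0.sin).div_const (2 * u)).sub (h0.cos.div_const (4 * l * u ^ 2))).congr_deriv ?_
    field_simp
    ring
  rw [intervalIntegral.integral_eq_sub_of_hasDerivAt hd
    (Continuous.intervalIntegrable (by fun_prop) _ _)]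
  rw [sinc_of_ne_zero (mul_ne_zero hl.ne' hu), show 2 * l * u = 2 * (l * u) by ring, cos_two_mul]
  have := sin_sq_add_cos_sq (l * u)
  simp
  field_simp
  linear_combination (-4) * this

/-- The Fejér kernel as the Fourier transform of the tent function. -/
lemma integral_tent_mul_cexp {l : ℝ} (hl : 0 < l) {u : ℝ} (hu : u ≠ 0) :
    ∫ t in (-l)..l, ((1 - |t| / l : ℝ) : ℂ) * Complex.exp (2 * t * u * Complex.I) =
      ((l * sinc (l * u) ^ 2 : ℝ) : ℂ) := by
  have hc : Continuous fun t : ℝ =>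
    ((1 - |t| / l : ℝ) : ℂ) * Complex.exp (2 * t * u * Complex.I) := by fun_prop
  rw [← intervalIntegral.integral_add_adjacent_intervals (b := 0)
    (hc.intervalIntegrable _ _) (hc.intervalIntegrable _ _)]
  have h1 := intervalIntegral.integral_comp_neg (a := 0) (b := l) fun t : ℝ =>
    ((1 - |t| / l : ℝ) : ℂ) * Complex.exp (2 * t * u * Complex.I)
  rw [neg_zero] at h1
  rw [← h1, ← intervalIntegral.integral_add
    (Continuous.intervalIntegrable (by fun_prop) _ _) (hc.intervalIntegrable _ _)]
  have h2 : ((l * sinc (l * u) ^ 2 : ℝ) : ℂ) =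
      ∫ t in (0 : ℝ)..l, ((2 * ((1 - t / l) * cos (2 * t * u)) : ℝ) : ℂ) := by
    rw [intervalIntegral.integral_ofReal, intervalIntegral.integral_const_mul,
      integral_tent_mul_cos hl hu]
    congr 1; ring
  rw [h2]
  refine intervalIntegral.integral_congr fun t ht => ?_
  rw [Set.uIcc_of_le hl.le] at ht
  simp only [abs_neg, abs_of_nonneg ht.1]
  push_cast
  rw [Complex.cos]
  ring_nf

lemma integral_mul_exp_mul_sinc_sq {h : ℝ → ℝ} (hm : Measurable h) {M : ℝ} (hM : ∀ u, |h u| ≤ M)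
    {G : ℂ → ℂ}
    (hL : ∀ s : ℂ, 0 < s.re → ∫ u in Set.Ioi (0 : ℝ), (h u : ℂ) * Complex.exp (-(s * u)) = G s)
    {l : ℝ} (hl : 0 < l) {c : ℝ} (hc : 0 < c) (v : ℝ) :
    ((∫ u in Set.Ioi (0 : ℝ), h u * exp (-(c * u)) * (l * sinc (l * (v - u)) ^ 2) : ℝ) : ℂ) =
      ∫ t in (-l)..l, ((1 - |t| / l : ℝ) : ℂ) * Complex.exp (2 * t * v * Complex.I) *
        G (c + 2 * t * Complex.I) := by
  let F : ℝ → ℝ → ℂ := fun u t => (h u : ℂ) * exp (-(c * u)) *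
    (((1 - |t| / l : ℝ) : ℂ) * Complex.exp (2 * t * (v - u : ℝ) * Complex.I))
  have hintg1 : Integrable (fun u => M * exp (-(c * u))) (volume.restrict (Set.Ioi 0)) := by
    simpa only [neg_mul, IntegrableOn] using (exp_neg_integrableOn_Ioi 0 hc).const_mul M
  have hintg2 : Integrable (fun t : ℝ => (1 - |t| / l : ℝ)) (volume.restrict (Set.Ioc (-l) l)) :=
    Continuous.integrableOn_Ioc (by fun_prop)
  have hF : Integrable (Function.uncurry F)
      ((volume.restrict (Set.Ioi 0)).prod (volume.restrict (Set.Ioc (-l) l))) := by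
    refine (hintg1.mul_prod hintg2.norm).mono' ?_ (Eventually.of_forall fun z => ?_)
    · refine Measurable.aestronglyMeasurable ?_
      simp only [F, Function.uncurry_def]
      fun_prop
    · simp only [F, Function.uncurry_def, norm_mul, Complex.norm_real]
      have : ‖Complex.exp (2 * z.2 * (v - z.1 : ℝ) * Complex.I)‖ = 1 := by
        have := Complex.norm_exp_ofReal_mul_I (2 * z.2 * (v - z.1))
        push_cast at this ⊢
        exact this
      rw [this, mul_one, norm_of_nonneg (exp_pos _).le]
      gcongr
      exact hM _
  have hle : -l ≤ l := by linarith
  calc _ = ∫ u in Set.Ioi (0 : ℝ),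
        ((h u * exp (-(c * u)) * (l * sinc (l * (v - u)) ^ 2) : ℝ) : ℂ) := by
        exact integral_ofReal.symm
    _ = ∫ u in Set.Ioi (0 : ℝ), ∫ t in Set.Ioc (-l) l, F u t := by
        refine integral_congr_ae ?_
        have : ∀ᵐ u ∂(volume.restrict (Set.Ioi (0 : ℝ))), u ≠ v :=
          ae_restrict_of_ae (Measure.ae_ne volume v)
        filter_upwards [this] with u hu
        simp only [F]
        rw [integral_const_mul, ← intervalIntegral.integral_of_le hle,
          integral_tent_mul_cexp hl (sub_ne_zero.mpr hu.symm)]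
        push_cast
        ring
    _ = ∫ t in Set.Ioc (-l) l, ∫ u in Set.Ioi (0 : ℝ), F u t := integral_integral_swap hF
    _ = _ := by
        rw [intervalIntegral.integral_of_le hle]
        refine integral_congr_ae (Eventually.of_forall fun t => ?_)
        simp only [F]
        rw [← hL _ (by simpa using hc), ← integral_const_mul]
        refine integral_congr_ae (Eventually.of_forall fun u => ?_)
        simp only
        have : Complex.exp (-((c + 2 * t * Complex.I) * u)) =
            (exp (-(c * u)) : ℝ) * Complex.exp (-(2 * t * u * Complex.I)) := by
          push_cast
          rw [← Complex.exp_add]; ring_nf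
        rw [this]
        have h2 : Complex.exp (2 * t * (v - u : ℝ) * Complex.I) =
            Complex.exp (2 * t * v * Complex.I) * Complex.exp (-(2 * t * u * Complex.I)) := by
          rw [← Complex.exp_add]; push_cast; ring_nf
        rw [h2]
        ring

lemma integral_mul_sinc_sq {h : ℝ → ℝ} (hm : Measurable h) {M : ℝ} (hM : ∀ u, |h u| ≤ M)
    {G : ℂ → ℂ} (hG : ContinuousOn G {s | 0 ≤ s.re})
    (hL : ∀ s : ℂ, 0 < s.re → ∫ u in Set.Ioi (0 : ℝ), (h u : ℂ) * Complex.exp (-(s * u)) = G s)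
    {l : ℝ} (hl : 0 < l) (v : ℝ) :
    ((∫ u in Set.Ioi (0 : ℝ), h u * (l * sinc (l * (v - u)) ^ 2) : ℝ) : ℂ) =
      ∫ t in (-l)..l, ((1 - |t| / l : ℝ) : ℂ) * Complex.exp (2 * t * v * Complex.I) *
        G (2 * t * Complex.I) := by
  have hM0 : 0 ≤ M := (abs_nonneg _).trans (hM 0)
  have hsinc : Integrable (fun u => sinc (l * (v - u)) ^ 2) := by
    have := (integrable_sinc_sq.comp_mul_left' hl.ne').comp_sub_left v
    exact this
  have hlim1 : Tendsto (fun c : ℝ => ∫ u in Set.Ioi (0 : ℝ),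
      h u * exp (-(c * u)) * (l * sinc (l * (v - u)) ^ 2)) (𝓝[>] 0)
      (𝓝 (∫ u in Set.Ioi (0 : ℝ), h u * (l * sinc (l * (v - u)) ^ 2))) := by
    refine tendsto_integral_filter_of_dominated_convergence
      (fun u => M * (l * sinc (l * (v - u)) ^ 2)) ?_ ?_ ?_ ?_
    · refine Eventually.of_forall fun c => Measurable.aestronglyMeasurable ?_
      have := continuous_sinc.measurable
      fun_prop
    · filter_upwards [self_mem_nhdsWithin] with c hc
      refine (ae_restrict_iff' measurableSet_Ioi).mpr (Eventually.of_forall fun u hu => ?_)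
      rw [norm_mul, norm_mul, norm_of_nonneg (by positivity : 0 ≤ l * sinc (l * (v - u)) ^ 2),
        norm_of_nonneg (exp_pos _).le, Real.norm_eq_abs]
      have : exp (-(c * u)) ≤ 1 := by
        rw [exp_le_one_iff]; have := mul_pos (Set.mem_Ioi.mp hc) hu; linarith
      gcongr
      calc |h u| * exp (-(c * u)) ≤ M * 1 := by gcongr; exact hM u
        _ = M := mul_one M
    · exact ((hsinc.const_mul l).const_mul M).restrict
    · refine Eventually.of_forall fun u => ?_
      have : Tendsto (fun c : ℝ => h u * exp (-(c * u)) * (l * sinc (l * (v - u)) ^ 2)) (𝓝 0)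
          (𝓝 (h u * exp (-(0 * u)) * (l * sinc (l * (v - u)) ^ 2))) :=
        Continuous.tendsto (by fun_prop) 0
      simpa using this.mono_left nhdsWithin_le_nhds
  let K : Set ℂ := (fun z : ℝ × ℝ => (z.1 + 2 * z.2 * Complex.I : ℂ)) ''
    (Set.Icc 0 1 ×ˢ Set.Icc (-l) l)
  have hK : IsCompact K := (isCompact_Icc.prod isCompact_Icc).image (by fun_prop)
  obtain ⟨B, hB⟩ := hK.exists_bound_of_continuousOn (hG.mono (by
    rintro _ ⟨z, hz, rfl⟩
    simpa using hz.1.1))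
  have hlim2 : Tendsto (fun c : ℝ => ∫ t in (-l)..l,
      ((1 - |t| / l : ℝ) : ℂ) * Complex.exp (2 * t * v * Complex.I) *
        G (c + 2 * t * Complex.I)) (𝓝[>] 0)
      (𝓝 (∫ t in (-l)..l, ((1 - |t| / l : ℝ) : ℂ) * Complex.exp (2 * t * v * Complex.I) *
        G (2 * t * Complex.I))) := by
    have hcc : ∀ c : ℝ, 0 ≤ c → Continuous fun t : ℝ => G (c + 2 * t * Complex.I) := fun c hc =>
      hG.comp_continuous (by fun_prop) (fun t => by simpa using hc)
    refine intervalIntegral.tendsto_integral_filter_of_dominated_convergence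
      (fun _ => 1 * B) ?_ ?_ ?_ ?_
    · filter_upwards [self_mem_nhdsWithin] with c hc
      have := hcc c (Set.mem_Ioi.mp hc).le
      exact Continuous.aestronglyMeasurable (Continuous.mul (by fun_prop) this)
    · have h1 : ∀ᶠ c : ℝ in 𝓝[>] 0, c ≤ 1 :=
        nhdsWithin_le_nhds (eventually_le_nhds one_pos)
      filter_upwards [self_mem_nhdsWithin, h1] with c hc hc1
      refine Eventually.of_forall fun t ht => ?_
      rw [Set.uIoc_of_le (by linarith)] at ht
      have e1 : ‖Complex.exp (2 * t * v * Complex.I)‖ = 1 := by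
        have := Complex.norm_exp_ofReal_mul_I (2 * t * v)
        push_cast at this
        exact this
      rw [norm_mul, norm_mul, e1, mul_one, Complex.norm_real]
      have habs : |t| ≤ l := abs_le.mpr ⟨ht.1.le, ht.2⟩
      have h3 : |t| / l ≤ 1 := (div_le_one hl).mpr habs
      have h4 : 0 ≤ |t| / l := by positivity
      gcongr
      · rw [Real.norm_eq_abs, abs_le]; constructor <;> linarith
      · exact hB _ ⟨(c, t), ⟨⟨(Set.mem_Ioi.mp hc).le, hc1⟩, ht.1.le, ht.2⟩, by simp⟩
    · exact intervalIntegrable_const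
    · refine Eventually.of_forall fun t _ => Tendsto.const_mul _ ?_
      have h1 : Tendsto G (𝓝[{s | 0 ≤ s.re}] (2 * t * Complex.I)) (𝓝 (G (2 * t * Complex.I))) :=
        hG _ (by simp)
      refine h1.comp (tendsto_nhdsWithin_iff.mpr ⟨?_, ?_⟩)
      · have : Tendsto (fun c : ℝ => (c + 2 * t * Complex.I : ℂ)) (𝓝 0)
            (𝓝 ((0 : ℝ) + 2 * t * Complex.I)) := Continuous.tendsto (by fun_prop) 0
        simpa using this.mono_left nhdsWithin_le_nhds
      · filter_upwards [self_mem_nhdsWithin] with c hc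
        simpa using (Set.mem_Ioi.mp hc).le
  refine tendsto_nhds_unique ((Complex.continuous_ofReal.tendsto _).comp hlim1) (hlim2.congr' ?_)
  filter_upwards [self_mem_nhdsWithin] with c hc
  exact (integral_mul_exp_mul_sinc_sq hm hM hL hl hc v).symm

lemma tendsto_integral_mul_sinc_sq {h : ℝ → ℝ} (hm : Measurable h) {M : ℝ} (hM : ∀ u, |h u| ≤ M)
    {G : ℂ → ℂ} (hG : ContinuousOn G {s | 0 ≤ s.re})
    (hL : ∀ s : ℂ, 0 < s.re → ∫ u in Set.Ioi (0 : ℝ), (h u : ℂ) * Complex.exp (-(s * u)) = G s)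
    {l : ℝ} (hl : 0 < l) :
    Tendsto (fun v => ∫ u in Set.Ioi (0 : ℝ), h u * sinc (l * (v - u)) ^ 2) atTop (𝓝 0) := by
  have hle : -l ≤ l := by linarith
  have hRL := Real.tendsto_integral_exp_smul_cocompact ((Set.Ioc (-l) l).indicator fun t : ℝ =>
    ((1 - |t| / l : ℝ) : ℂ) * G (2 * t * Complex.I))
  have hw : Tendsto (fun v : ℝ => -(v / π)) atTop (cocompact ℝ) :=
    (tendsto_neg_atTop_atBot.comp (tendsto_id.atTop_div_const pi_pos)).mono_right
      atBot_le_cocompact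
  have h1 := hRL.comp hw
  have h2 : Tendsto (fun v =>
      ((∫ u in Set.Ioi (0 : ℝ), h u * (l * sinc (l * (v - u)) ^ 2) : ℝ) : ℂ)) atTop (𝓝 0) := by
    refine h1.congr fun v => ?_
    rw [integral_mul_sinc_sq hm hM hG hL hl v, intervalIntegral.integral_of_le hle,
      ← integral_indicator measurableSet_Ioc]
    refine integral_congr_ae (Eventually.of_forall fun t => ?_)
    simp only [Set.indicator]
    split_ifs with ht
    · rw [Circle.smul_def, Real.fourierChar_apply, smul_eq_mul]
      have : ((2 * π * (-(t * -(v / π))) : ℝ) : ℂ) * Complex.I = 2 * t * v * Complex.I := by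
        have : 2 * π * (-(t * -(v / π))) = 2 * t * v := by
          field_simp
        rw [this]; push_cast; ring
      rw [this]; ring
    · simp
  have h3 := (Complex.continuous_re.tendsto _).comp h2
  simp only [Function.comp_def, Complex.ofReal_re, Complex.zero_re] at h3
  have h4 := h3.const_mul l⁻¹
  rw [mul_zero] at h4
  refine h4.congr fun v => ?_
  rw [← integral_const_mul]
  refine integral_congr_ae (Eventually.of_forall fun u => ?_)
  simp only
  field_simp

lemma tendsto_setIntegral_comp_sub_left {k : ℝ → ℝ} (hk : Integrable k) :
    Tendsto (fun v => ∫ u in Set.Ioi (0 : ℝ), k (v - u)) atTop (𝓝 (∫ x, k x)) := by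
  have h1 : ∀ v, ∫ u in Set.Ioi (0 : ℝ), k (v - u) = ∫ x in Set.Iio v, k x := by
    intro v
    rw [← integral_indicator measurableSet_Ioi, ← integral_indicator measurableSet_Iio,
      ← integral_sub_left_eq_self _ volume v]
    refine integral_congr_ae (Eventually.of_forall fun u => ?_)
    simp [Set.indicator]
  simp_rw [h1]
  have := tendsto_setIntegral_of_monotone (μ := volume) (f := k) (s := fun v : ℝ => Set.Iio v)
    (fun _ => measurableSet_Iio) (fun a b hab => Set.Iio_subset_Iio hab) hk.integrableOn
  have hU : ⋃ v : ℝ, Set.Iio v = Set.univ := Set.iUnion_Iio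
  simpa [hU] using this

/-- For every `δ, ε > 0` some dilate of the normalised Fejér kernel has mass at least `1 - ε` on
`[-δ, δ]`. -/
lemma exists_sinc_sq_concentrated {δ ε : ℝ} (hδ : 0 < δ) (hε : 0 < ε) :
    ∃ l > 0, (1 - ε) * ∫ x, sinc (l * x) ^ 2 ≤ ∫ x in Set.Icc (-δ) δ, sinc (l * x) ^ 2 := by
  have hI := integral_sinc_sq_pos
  have h1 : Tendsto (fun n : ℝ => ∫ x in Set.Icc (-n) n, sinc x ^ 2) atTop
      (𝓝 (∫ x, sinc x ^ 2)) := by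
    have := tendsto_setIntegral_of_monotone (μ := volume) (f := fun x => sinc x ^ 2)
      (s := fun n : ℝ => Set.Icc (-n) n)
      (fun _ => measurableSet_Icc) (fun a b hab => Set.Icc_subset_Icc (neg_le_neg hab) hab)
      integrable_sinc_sq.integrableOn
    have hU : ⋃ n : ℝ, Set.Icc (-n) n = Set.univ :=
      Set.eq_univ_of_forall fun x => Set.mem_iUnion.mpr ⟨|x|, abs_le.mp le_rfl⟩
    simpa [hU] using this
  have h2 : (1 - ε) * ∫ x, sinc x ^ 2 < ∫ x, sinc x ^ 2 := by nlinarith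
  obtain ⟨n, hn, hn0⟩ := ((h1.eventually (lt_mem_nhds h2)).and (eventually_gt_atTop 0)).exists
  refine ⟨n / δ, by positivity, ?_⟩
  have hl : 0 < n / δ := by positivity
  have e1 : ∫ x, sinc (n / δ * x) ^ 2 = (n / δ)⁻¹ * ∫ x, sinc x ^ 2 := by
    have := Measure.integral_comp_mul_left (fun x => sinc x ^ 2) (n / δ)
    rw [this, abs_of_pos (by positivity), smul_eq_mul]
  have e2 : ∫ x in Set.Icc (-δ) δ, sinc (n / δ * x) ^ 2 =
      (n / δ)⁻¹ * ∫ x in Set.Icc (-n) n, sinc x ^ 2 := by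
    rw [integral_Icc_eq_integral_Ioc, integral_Icc_eq_integral_Ioc,
      ← intervalIntegral.integral_of_le (by linarith),
      ← intervalIntegral.integral_of_le (by linarith),
      intervalIntegral.integral_comp_mul_left (fun x => sinc x ^ 2) hl.ne', smul_eq_mul]
    congr 2 <;> field_simp
  rw [e1, e2]
  have : 0 < (n / δ)⁻¹ := by positivity
  nlinarith

/-- A slowly decreasing bounded function whose Fejér means converge to `A` converges to `A`. -/
lemma tendsto_of_tendsto_fejer_mean {g : ℝ → ℝ} (hgm : Measurable g) {M A : ℝ}
    (hg0 : ∀ u, 0 ≤ g u) (hgM : ∀ u, g u ≤ M)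
    (hmono : ∀ u w, u ≤ w → g u * exp u ≤ g w * exp w)
    (hlim : ∀ l > 0, Tendsto (fun v => ∫ u in Set.Ioi (0 : ℝ), (g u - A) * sinc (l * (v - u)) ^ 2)
      atTop (𝓝 0)) :
    Tendsto g atTop (𝓝 A) := by
  have hintg : ∀ l > 0, Integrable (fun x => sinc (l * x) ^ 2) := fun l hl =>
    integrable_sinc_sq.comp_mul_left' (ne_of_gt hl)
  have hintg' : ∀ l > 0, ∀ v, Integrable (fun u => sinc (l * (v - u)) ^ 2) := fun l hl v =>
    (hintg l hl).comp_sub_left v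
  have hgint : ∀ l > 0, ∀ v, Integrable (fun u => g u * sinc (l * (v - u)) ^ 2) := fun l hl v => by
    refine (hintg' l hl v).bdd_mul (c := M) hgm.aestronglyMeasurable (Eventually.of_forall fun u => ?_)
    rw [norm_of_nonneg (hg0 u)]; exact hgM u
  have hpos : ∀ l > 0, 0 < ∫ x, sinc (l * x) ^ 2 := fun l hl => by
    rw [Measure.integral_comp_mul_left (fun x => sinc x ^ 2) l]
    have := integral_sinc_sq_pos
    have hl' : 0 < l := hl
    simp only [smul_eq_mul]
    positivity
  have hlim' : ∀ l > 0, Tendsto (fun v => ∫ u in Set.Ioi (0 : ℝ), g u * sinc (l * (v - u)) ^ 2)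
      atTop (𝓝 (A * ∫ x, sinc (l * x) ^ 2)) := by
    intro l hl
    have h := (hlim l hl).add ((tendsto_setIntegral_comp_sub_left (hintg l hl)).const_mul A)
    rw [zero_add] at h
    refine h.congr fun v => ?_
    rw [← integral_const_mul, ← integral_add]
    · refine integral_congr_ae (Eventually.of_forall fun u => ?_)
      simp only; ring
    · simp_rw [sub_mul]
      exact ((hgint l hl v).sub ((hintg' l hl v).const_mul A)).restrict
    · exact ((hintg' l hl v).const_mul A).restrict
  have hIcc : ∀ l v a δ : ℝ, ∫ u in Set.Icc (v - δ) (v + δ), sinc (l * (v - u)) ^ 2 * a =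
      (∫ x in Set.Icc (-δ) δ, sinc (l * x) ^ 2) * a := by
    intro l v a δ
    rw [integral_mul_const]
    congr 1
    rw [← integral_indicator measurableSet_Icc, ← integral_indicator measurableSet_Icc,
      ← integral_sub_left_eq_self _ volume v]
    refine integral_congr_ae (Eventually.of_forall fun u => ?_)
    simp only [Set.indicator, Set.mem_Icc]
    rw [sub_sub_cancel]
    congr 1
    apply propext
    constructor <;> rintro ⟨h1, h2⟩ <;> constructor <;> linarith
  have hM0 : 0 ≤ M := (hg0 0).trans (hgM 0)
  have hupper : ∀ δ > 0, ∀ ε > 0, ε < 1 → ∀ᶠ v in atTop, g v * (exp (-(2 * δ)) * (1 - ε)) ≤ A + ε := by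
    intro δ hδ ε hε hε1
    obtain ⟨l, hl, hconc⟩ := exists_sinc_sq_concentrated hδ hε
    have hp := hpos l hl
    have h1 : A * ∫ x, sinc (l * x) ^ 2 < (A + ε) * ∫ x, sinc (l * x) ^ 2 := by nlinarith
    have h2 := ((hlim' l hl).comp (tendsto_atTop_add_const_right atTop δ tendsto_id)).eventually
      (gt_mem_nhds h1)
    filter_upwards [h2, eventually_gt_atTop 0] with v hv hv0
    simp only [Function.comp, id] at hv
    have h3 : (∫ x in Set.Icc (-δ) δ, sinc (l * x) ^ 2) * (g v * exp (-(2 * δ))) ≤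
        ∫ u in Set.Ioi (0 : ℝ), g u * sinc (l * (v + δ - u)) ^ 2 := by
      rw [← hIcc l (v + δ)]
      calc _ ≤ ∫ u in Set.Icc (v + δ - δ) (v + δ + δ), g u * sinc (l * (v + δ - u)) ^ 2 := by
            refine setIntegral_mono_on ((hintg' l hl _).mul_const _).integrableOn
              (hgint l hl _).integrableOn measurableSet_Icc fun u hu => ?_
            rw [mul_comm]
            gcongr
            have := hmono v u (by linarith [hu.1])
            have h5 : g v * exp (-(2 * δ)) ≤ g v * exp (v - u) := by
              gcongr
              · exact hg0 v
              · linarith [hu.2]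
            refine h5.trans ?_
            rw [exp_sub, mul_div_assoc', div_le_iff₀ (exp_pos _)]
            exact this
        _ ≤ _ := by
            refine setIntegral_mono_set (hgint l hl _).integrableOn
              (Eventually.of_forall fun u => mul_nonneg (hg0 u) (sq_nonneg _))
              (Eventually.of_forall fun u hu => ?_)
            have := (Set.mem_Icc.mp hu).1
            show (0 : ℝ) < u
            linarith
    have h4 : 0 ≤ g v * exp (-(2 * δ)) := mul_nonneg (hg0 v) (exp_pos _).le
    have h5 := mul_le_mul_of_nonneg_right hconc h4
    have h6 : (g v * (exp (-(2 * δ)) * (1 - ε))) * (∫ x, sinc (l * x) ^ 2) ≤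
        (A + ε) * ∫ x, sinc (l * x) ^ 2 := by nlinarith
    exact le_of_mul_le_mul_right h6 hp
  have hlower : ∀ δ > 0, ∀ ε > 0, ∀ᶠ v in atTop, A - ε ≤ g v * exp (2 * δ) + M * ε := by
    intro δ hδ ε hε
    obtain ⟨l, hl, hconc⟩ := exists_sinc_sq_concentrated hδ hε
    have hp := hpos l hl
    have h1 : (A - ε) * ∫ x, sinc (l * x) ^ 2 < A * ∫ x, sinc (l * x) ^ 2 := by nlinarith
    have h2 := ((hlim' l hl).comp (tendsto_atTop_add_const_right atTop (-δ) tendsto_id)).eventually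
      (lt_mem_nhds h1)
    filter_upwards [h2] with v hv
    simp only [Function.comp, id] at hv
    have h3 : ∫ u in Set.Ioi (0 : ℝ), g u * sinc (l * (v + -δ - u)) ^ 2 ≤
        (∫ x in Set.Icc (-δ) δ, sinc (l * x) ^ 2) * (g v * exp (2 * δ)) +
        ((∫ x, sinc (l * x) ^ 2) - ∫ x in Set.Icc (-δ) δ, sinc (l * x) ^ 2) * M := by
      have e1 : (∫ x, sinc (l * x) ^ 2) * M = ∫ u, sinc (l * (v + -δ - u)) ^ 2 * M := by
        rw [integral_mul_const, integral_sub_left_eq_self (fun x => sinc (l * x) ^ 2) volume]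
      rw [sub_mul, e1, ← hIcc l (v + -δ), ← hIcc l (v + -δ),
        ← integral_add_compl measurableSet_Icc ((hintg' l hl _).mul_const M),
        add_sub_cancel_left]
      calc _ ≤ ∫ u, g u * sinc (l * (v + -δ - u)) ^ 2 :=
            setIntegral_le_integral (hgint l hl _)
              (Eventually.of_forall fun u => mul_nonneg (hg0 u) (sq_nonneg _))
        _ = _ := (integral_add_compl (s := Set.Icc (v + -δ - δ) (v + -δ + δ)) measurableSet_Icc (hgint l hl _)).symm
        _ ≤ _ := by
            refine add_le_add ?_ ?_
            · refine setIntegral_mono_on (hgint l hl _).integrableOn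
                ((hintg' l hl _).mul_const _).integrableOn measurableSet_Icc fun u hu => ?_
              rw [mul_comm]
              gcongr
              have := hmono u v (by linarith [hu.2])
              have h5 : g v * exp (v - u) ≤ g v * exp (2 * δ) := by
                gcongr
                · exact hg0 v
                · linarith [hu.1]
              refine le_trans ?_ h5
              rw [exp_sub, mul_div_assoc', le_div_iff₀ (exp_pos _)]
              exact this
            · refine setIntegral_mono_on (hgint l hl _).integrableOn
                ((hintg' l hl _).mul_const _).integrableOn measurableSet_Icc.compl fun u hu => ?_
              rw [mul_comm]
              gcongr
              exact hgM u
    have h4 : (∫ x in Set.Icc (-δ) δ, sinc (l * x) ^ 2) ≤ ∫ x, sinc (l * x) ^ 2 :=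
      setIntegral_le_integral (hintg l hl) (Eventually.of_forall fun u => sq_nonneg _)
    have h7 : 0 ≤ g v * exp (2 * δ) := mul_nonneg (hg0 v) (exp_pos _).le
    have h5 := mul_le_mul_of_nonneg_right h4 h7
    have h8 := mul_le_mul_of_nonneg_right hconc hM0
    have h6 : (A - ε) * (∫ x, sinc (l * x) ^ 2) ≤
        (g v * exp (2 * δ) + M * ε) * ∫ x, sinc (l * x) ^ 2 := by nlinarith
    exact le_of_mul_le_mul_right h6 hp
  refine tendsto_order.mpr ⟨fun a ha => ?_, fun a ha => ?_⟩
  · have ht : Tendsto (fun ε : ℝ => (A - ε - M * ε) / exp (2 * ε)) (𝓝 0)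
        (𝓝 ((A - 0 - M * 0) / exp (2 * 0))) :=
      Continuous.tendsto (f := fun ε : ℝ => (A - ε - M * ε) / exp (2 * ε))
        (Continuous.div (by fun_prop) (by fun_prop) fun _ => (exp_pos _).ne') 0
    simp only [mul_zero, sub_zero, exp_zero, div_one] at ht
    obtain ⟨ε, hε, hε0⟩ := (((ht.mono_left nhdsWithin_le_nhds).eventually (lt_mem_nhds ha)).and
      (self_mem_nhdsWithin (s := Set.Ioi 0))).exists
    filter_upwards [hlower ε hε0 ε hε0] with v hv
    refine hε.trans_le ?_
    rw [div_le_iff₀ (exp_pos _)]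
    linarith
  · have ht : Tendsto (fun ε : ℝ => (A + ε) / (exp (-(2 * ε)) * (1 - ε))) (𝓝 0)
        (𝓝 ((A + 0) / (exp (-(2 * 0)) * (1 - 0)))) :=
      ContinuousAt.tendsto (f := fun ε : ℝ => (A + ε) / (exp (-(2 * ε)) * (1 - ε)))
        (ContinuousAt.div (by fun_prop) (by fun_prop) (by simp))
    simp only [mul_zero, sub_zero, add_zero, neg_zero, exp_zero, div_one, mul_one] at ht
    obtain ⟨ε, ⟨hε, hε1⟩, hε0⟩ := (((ht.mono_left nhdsWithin_le_nhds).eventually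
      (gt_mem_nhds ha)).and (nhdsWithin_le_nhds (gt_mem_nhds one_pos)) |>.and
      (self_mem_nhdsWithin (s := Set.Ioi (0 : ℝ)))).exists
    filter_upwards [hupper ε hε0 ε hε0 hε1] with v hv
    refine lt_of_le_of_lt ?_ hε
    rw [le_div_iff₀ (mul_pos (exp_pos _) (by linarith))]
    exact hv

/-- The **Wiener-Ikehara theorem**, under an a priori Chebyshev bound on the partial sums. -/
theorem wiener_ikehara {a : ℕ → ℝ} (ha : ∀ n, 0 ≤ a n) {M A : ℝ}
    (hM : ∀ x : ℝ, 0 ≤ x → ∑ n ∈ Finset.Icc 1 ⌊x⌋₊, a n ≤ M * x) {G : ℂ → ℂ}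
    (hG : ContinuousOn G {s | 1 ≤ s.re})
    (hGL : ∀ s : ℂ, 1 < s.re → G s = LSeries (fun n => (a n : ℂ)) s - A / (s - 1)) :
    Tendsto (fun x : ℝ => (∑ n ∈ Finset.Icc 1 ⌊x⌋₊, a n) / x) atTop (𝓝 A) := by
  set S : ℝ → ℝ := fun x => ∑ n ∈ Finset.Icc 1 ⌊x⌋₊, a n with hS
  have hSmono : Monotone S := fun x y hxy =>
    Finset.sum_le_sum_of_subset_of_nonneg
      (Finset.Icc_subset_Icc le_rfl (Nat.floor_le_floor hxy)) fun n _ _ => ha n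
  have hS0 : ∀ x, 0 ≤ S x := fun x => Finset.sum_nonneg fun n _ => ha n
  have hM0 : 0 ≤ M := by
    have := (hS0 1).trans (hM 1 zero_le_one)
    linarith
  set g : ℝ → ℝ := fun u => S (exp u) / exp u with hg
  have hgm : Measurable g := (hSmono.measurable.comp measurable_exp).div measurable_exp
  have hg0 : ∀ u, 0 ≤ g u := fun u => div_nonneg (hS0 _) (exp_pos _).le
  have hgM : ∀ u, g u ≤ M := fun u => (div_le_iff₀ (exp_pos u)).mpr (hM _ (exp_pos u).le)
  have hge : ∀ u, g u * exp u = S (exp u) := fun u => div_mul_cancel₀ _ (exp_pos u).ne'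
  have hlim : Tendsto g atTop (𝓝 A) := by
    refine tendsto_of_tendsto_fejer_mean hgm hg0 hgM (fun u w huw => ?_) fun l hl => ?_
    · rw [hge, hge]
      exact hSmono (exp_le_exp.mpr huw)
    refine tendsto_integral_mul_sinc_sq (hgm.sub_const A) (M := M + |A|) (fun u => ?_)
      (G := fun s => (G (1 + s) - A) / (1 + s)) ?_ (fun s hs => ?_) hl
    · refine (abs_sub _ _).trans ?_
      rw [abs_of_nonneg (hg0 u)]
      gcongr
      exact hgM u
    · refine ContinuousOn.div ((hG.comp (by fun_prop) fun s hs => ?_).sub continuousOn_const)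
        (by fun_prop) fun s hs h => ?_
      · simpa using hs
      · have := congrArg Complex.re h
        simp only [Set.mem_ofPred_eq] at hs
        simp at this
        linarith
    · have hs1 : 1 < (1 + s).re := by simpa using hs
      have hO : (fun n ↦ ∑ k ∈ Finset.Icc 1 n, a k) =O[atTop] fun n ↦ (n : ℝ) ^ (1 : ℝ) := by
        refine Asymptotics.IsBigO.of_bound M (Eventually.of_forall fun n => ?_)
        rw [rpow_one, norm_of_nonneg (Finset.sum_nonneg fun n _ => ha n), norm_of_nonneg (by positivity)]
        simpa using hM n n.cast_nonneg
      have hLS := LSeries_eq_mul_integral_of_nonneg a zero_le_one hs1 hO ha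
      have hne : (1 + s) ≠ 0 := fun h => by rw [h] at hs1; simp at hs1; linarith
      have hs0 : s ≠ 0 := fun h => by rw [h] at hs; simp at hs
      have hintg2 : ∫ u in Set.Ioi (0 : ℝ), Complex.exp (-(s * u)) = 1 / s := by
        have := integral_exp_mul_complex_Ioi (a := -s) (by simpa using hs) 0
        simp only [neg_mul] at this
        rw [this]; simp
      have hi2 : IntegrableOn (fun u : ℝ => Complex.exp (-(s * u))) (Set.Ioi 0) := by
        have := integrableOn_exp_mul_complex_Ioi (a := -s) (by simpa using hs) 0
        simpa only [neg_mul] using this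
      have hintg1 : ∫ u in Set.Ioi (0 : ℝ), (g u : ℂ) * Complex.exp (-(s * u)) =
          LSeries (fun n => (a n : ℂ)) (1 + s) / (1 + s) := by
        rw [hLS, mul_div_cancel_left₀ _ hne]
        have := integral_comp_exp_Ioi
          (fun t : ℝ => (∑ k ∈ Finset.Icc 1 ⌊t⌋₊, (a k : ℂ)) * (t : ℂ) ^ (-((1 + s) + 1))) 0
        rw [exp_zero] at this
        rw [← this]
        refine integral_congr_ae (Eventually.of_forall fun u => ?_)
        simp only [hg, hS, Complex.real_smul]
        have e1 : ((exp u : ℝ) : ℂ) ^ (-((1 + s) + 1)) =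
            Complex.exp (-(s * u)) * Complex.exp (-(2 * u)) := by
          rw [Complex.cpow_def_of_ne_zero (by exact_mod_cast (exp_pos u).ne'), ← Complex.ofReal_log (exp_pos u).le, log_exp,
            ← Complex.exp_add]
          ring_nf
        rw [e1]
        push_cast
        have e2 : Complex.exp (-(2 * u)) = (Complex.exp u)⁻¹ * (Complex.exp u)⁻¹ := by
          rw [← Complex.exp_neg, ← Complex.exp_add]; ring_nf
        rw [e2]
        have := Complex.exp_ne_zero u
        field_simp
      have hi1 : IntegrableOn (fun u : ℝ => (g u : ℂ) * Complex.exp (-(s * u))) (Set.Ioi 0) := by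
        refine Integrable.bdd_mul (c := M) hi2
          (Complex.measurable_ofReal.comp hgm).aestronglyMeasurable (Eventually.of_forall fun u => ?_)
        rw [Complex.norm_real, norm_of_nonneg (hg0 u)]
        exact hgM u
      have : ∀ u : ℝ, ((g u - A : ℝ) : ℂ) * Complex.exp (-(s * u)) =
          (g u : ℂ) * Complex.exp (-(s * u)) - A * Complex.exp (-(s * u)) := fun u => by
        push_cast; ring
      simp_rw [this]
      rw [integral_sub hi1 (hi2.const_mul _), integral_const_mul, hintg1, hintg2, hGL _ hs1]
      rw [add_sub_cancel_left]
      field_simp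
      ring
  refine (hlim.comp tendsto_log_atTop).congr' ?_
  filter_upwards [eventually_gt_atTop 0] with x hx
  simp only [hg, hS, Function.comp, exp_log hx]

open ArithmeticFunction in
/-- The prime number theorem in arithmetic progressions, for the Chebyshev function. -/
theorem tendsto_sum_residueClass {q : ℕ} [NeZero q] {a : ZMod q} (ha : IsUnit a) :
    Tendsto (fun x : ℝ => (∑ n ∈ Finset.Icc 1 ⌊x⌋₊, vonMangoldt.residueClass a n) / x) atTop
      (𝓝 (q.totient : ℝ)⁻¹) := by
  refine wiener_ikehara (M := Real.log 4 + 4) (vonMangoldt.residueClass_nonneg a) (fun x hx => ?_)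
    (vonMangoldt.continuousOn_LFunctionResidueClassAux a) fun s hs => ?_
  · refine le_trans ?_ (Chebyshev.psi_le_const_mul_self hx)
    rw [Chebyshev.psi]
    exact Finset.sum_le_sum fun n _ => vonMangoldt.residueClass_le a n
  · rw [vonMangoldt.eqOn_LFunctionResidueClassAux ha hs]
    simp

section Karamata

variable {c d : ℕ → ℝ} {r C : ℝ}

lemma abs_tsum_mul_comp_le (hc : ∀ m, 0 ≤ c m) (hd : ∀ m, 0 ≤ d m)
    {s : ℝ} (hs : 0 < s) (hsum : Summable fun m => c m * exp (-(s * d m)))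
    {f : ℝ → ℝ} {B : ℝ} (hf : ∀ y ∈ Set.Icc (0 : ℝ) 1, |f y| ≤ B) :
    (Summable fun m => c m * exp (-(s * d m)) * f (exp (-(s * d m)))) ∧
    |∑' m, c m * exp (-(s * d m)) * f (exp (-(s * d m)))| ≤ B * ∑' m, c m * exp (-(s * d m)) := by
  have hb : ∀ m, ‖c m * exp (-(s * d m)) * f (exp (-(s * d m)))‖ ≤ B * (c m * exp (-(s * d m))) := by
    intro m
    have h1 : exp (-(s * d m)) ≤ 1 := exp_le_one_iff.mpr (by have := hd m; nlinarith [mul_nonneg hs.le this])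
    have h2 := hf _ ⟨(exp_pos (-(s * d m))).le, h1⟩
    have h3 : 0 ≤ c m * exp (-(s * d m)) := mul_nonneg (hc m) (exp_pos _).le
    rw [norm_mul, norm_of_nonneg h3, mul_comm, Real.norm_eq_abs]
    gcongr
  have h1 := hsum.mul_left B
  refine ⟨Summable.of_norm_bounded h1 hb, ?_⟩
  rw [← tsum_mul_left]
  exact tsum_of_norm_bounded h1.hasSum hb

lemma tendsto_karamata_polynomial (hr : 0 < r) (hc : ∀ m, 0 ≤ c m) (hd : ∀ m, 0 ≤ d m)
    (hsum : ∀ s > 0, Summable fun m => c m * exp (-(s * d m)))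
    (hlim : Tendsto (fun s : ℝ => s ^ r * ∑' m, c m * exp (-(s * d m))) (𝓝[>] 0) (𝓝 C))
    (p : Polynomial ℝ) :
    Tendsto (fun s : ℝ => s ^ r * ∑' m, c m * exp (-(s * d m)) * p.eval (exp (-(s * d m))))
      (𝓝[>] 0) (𝓝 (C / Gamma r * ∫ u in Set.Ioi 0, exp (-u) * u ^ (r - 1) * p.eval (exp (-u)))) := by
  have hsm : ∀ (q : Polynomial ℝ), ∀ s > 0, Summable fun m =>
      c m * exp (-(s * d m)) * q.eval (exp (-(s * d m))) := by
    intro q s hs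
    obtain ⟨B, hB⟩ := isCompact_Icc.exists_bound_of_continuousOn
      (q.continuous.continuousOn (s := Set.Icc (0 : ℝ) 1))
    exact (abs_tsum_mul_comp_le hc hd hs (hsum s hs) hB).1
  have hin : ∀ q : Polynomial ℝ,
      IntegrableOn (fun u => exp (-u) * u ^ (r - 1) * q.eval (exp (-u))) (Set.Ioi 0) := by
    intro q
    obtain ⟨B, hB⟩ := isCompact_Icc.exists_bound_of_continuousOn
      (q.continuous.continuousOn (s := Set.Icc (0 : ℝ) 1))
    refine Integrable.mul_bdd (c := B) (Real.GammaIntegral_convergent hr)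
      (Continuous.aestronglyMeasurable (by fun_prop)) ?_
    refine (ae_restrict_iff' measurableSet_Ioi).mpr (Eventually.of_forall fun u hu => ?_)
    exact hB _ ⟨(exp_pos _).le, exp_le_one_iff.mpr (by have := Set.mem_Ioi.mp hu; linarith)⟩
  induction p using Polynomial.induction_on' with
  | add p q hp hq =>
    have := hp.add hq
    rw [← mul_add, ← integral_add (hin p) (hin q)] at this
    simp only [← mul_add, ← Polynomial.eval_add] at this
    refine this.congr' ?_
    filter_upwards [self_mem_nhdsWithin] with s hs
    rw [← (hsm p s hs).tsum_add (hsm q s hs)]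
    simp only [← mul_add, ← Polynomial.eval_add]
  | monomial k a =>
    have hk : (0 : ℝ) < k + 1 := by positivity
    have h1 : Tendsto (fun s : ℝ => (k + 1) * s) (𝓝[>] 0) (𝓝[>] 0) := by
      refine tendsto_nhdsWithin_iff.mpr ⟨?_, ?_⟩
      · have : Tendsto (fun s : ℝ => (k + 1) * s) (𝓝 0) (𝓝 ((k + 1) * 0)) :=
          Continuous.tendsto (by fun_prop) 0
        rw [mul_zero] at this
        exact this.mono_left nhdsWithin_le_nhds
      · filter_upwards [self_mem_nhdsWithin] with s hs
        exact mul_pos hk hs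
    have h2 := ((hlim.comp h1).const_mul ((k + 1 : ℝ) ^ r)⁻¹).const_mul a
    have e : C / Gamma r * ∫ u in Set.Ioi 0, exp (-u) * u ^ (r - 1) *
        (Polynomial.monomial k a).eval (exp (-u)) = a * (((k + 1 : ℝ) ^ r)⁻¹ * C) := by
      have := Real.integral_rpow_mul_exp_neg_mul_Ioi hr hk
      have h3 : ∀ u : ℝ, exp (-u) * u ^ (r - 1) * (Polynomial.monomial k a).eval (exp (-u)) =
          a * (u ^ (r - 1) * exp (-((k + 1) * u))) := by
        intro u
        have : exp (-((k + 1) * u)) = exp (-u) * exp (-u) ^ k := by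
          rw [← exp_nat_mul, ← exp_add]; ring_nf
        rw [Polynomial.eval_monomial, this]; ring
      simp_rw [h3]
      rw [integral_const_mul, this, one_div, inv_rpow hk.le]
      have := (Gamma_pos_of_pos hr).ne'
      field_simp
    rw [e]
    refine h2.congr' ?_
    filter_upwards [self_mem_nhdsWithin] with s hs
    have hs' : 0 < s := hs
    simp only [Function.comp]
    rw [mul_rpow hk.le hs'.le, mul_assoc, inv_mul_cancel_left₀ (rpow_pos_of_pos hk r).ne',
      mul_left_comm, ← tsum_mul_left]
    congr 2
    funext m
    have : exp (-((k + 1) * s * d m)) = exp (-(s * d m)) * exp (-(s * d m)) ^ k := by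
      rw [← exp_nat_mul, ← exp_add]; ring_nf
    rw [Polynomial.eval_monomial, this]; ring

lemma tendsto_karamata_continuous (hr : 0 < r) (hc : ∀ m, 0 ≤ c m) (hd : ∀ m, 0 ≤ d m)
    (hsum : ∀ s > 0, Summable fun m => c m * exp (-(s * d m)))
    (hlim : Tendsto (fun s : ℝ => s ^ r * ∑' m, c m * exp (-(s * d m))) (𝓝[>] 0) (𝓝 C))
    {f : ℝ → ℝ} (hf : Continuous f) :
    Tendsto (fun s : ℝ => s ^ r * ∑' m, c m * exp (-(s * d m)) * f (exp (-(s * d m))))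
      (𝓝[>] 0) (𝓝 (C / Gamma r * ∫ u in Set.Ioi 0, exp (-u) * u ^ (r - 1) * f (exp (-u)))) := by
  have hin : ∀ {q : ℝ → ℝ}, Continuous q →
      IntegrableOn (fun u => exp (-u) * u ^ (r - 1) * q (exp (-u))) (Set.Ioi 0) := by
    intro q hq
    obtain ⟨B, hB⟩ := isCompact_Icc.exists_bound_of_continuousOn
      (hq.continuousOn (s := Set.Icc (0 : ℝ) 1))
    refine Integrable.mul_bdd (c := B) (Real.GammaIntegral_convergent hr)
      (Continuous.aestronglyMeasurable (by fun_prop)) ?_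
    refine (ae_restrict_iff' measurableSet_Ioi).mpr (Eventually.of_forall fun u hu => ?_)
    exact hB _ ⟨(exp_pos _).le, exp_le_one_iff.mpr (by have := Set.mem_Ioi.mp hu; linarith)⟩
  have hC : 0 ≤ C := by
    refine ge_of_tendsto hlim ?_
    filter_upwards [self_mem_nhdsWithin] with s hs
    exact mul_nonneg (rpow_nonneg (Set.mem_Ioi.mp hs).le r)
      (tsum_nonneg fun m => mul_nonneg (hc m) (exp_pos _).le)
  have hG := Gamma_pos_of_pos hr
  rw [Metric.tendsto_nhds]
  intro ε hε
  set η := ε / (2 * C + 3) with hη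
  have hη0 : 0 < η := by positivity
  obtain ⟨p, hp⟩ := exists_polynomial_near_of_continuousOn 0 1 f hf.continuousOn η hη0
  have h1 := Metric.tendsto_nhds.mp (tendsto_karamata_polynomial hr hc hd hsum hlim p) η hη0
  have h2 : ∀ᶠ s in 𝓝[>] (0 : ℝ), s ^ r * ∑' m, c m * exp (-(s * d m)) < C + 1 :=
    hlim.eventually (gt_mem_nhds (by linarith))
  have h3 : |(C / Gamma r * ∫ u in Set.Ioi 0, exp (-u) * u ^ (r - 1) * p.eval (exp (-u))) -
      (C / Gamma r * ∫ u in Set.Ioi 0, exp (-u) * u ^ (r - 1) * f (exp (-u)))| ≤ C * η := by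
    rw [← mul_sub, ← integral_sub (hin p.continuous) (hin hf), abs_mul, abs_of_nonneg (by positivity)]
    have : |∫ u in Set.Ioi 0, exp (-u) * u ^ (r - 1) * p.eval (exp (-u)) -
        exp (-u) * u ^ (r - 1) * f (exp (-u))| ≤ Gamma r * η := by
      rw [Gamma_eq_integral hr, ← integral_mul_const]
      rw [← Real.norm_eq_abs]
      refine norm_integral_le_of_norm_le ((Real.GammaIntegral_convergent hr).mul_const η) ?_
      refine (ae_restrict_iff' measurableSet_Ioi).mpr (Eventually.of_forall fun u hu => ?_)
      have hu' : 0 < u := hu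
      rw [← mul_sub, norm_mul, norm_of_nonneg (by positivity)]
      gcongr
      exact (hp _ ⟨(exp_pos _).le, exp_le_one_iff.mpr (by linarith)⟩).le
    calc _ ≤ C / Gamma r * (Gamma r * η) := by gcongr
      _ = C * η := by field_simp
  filter_upwards [h1, h2, self_mem_nhdsWithin] with s hs1 hs2 hs0
  have hs0' : 0 < s := hs0
  rw [Real.dist_eq] at hs1 ⊢
  have hpb := abs_tsum_mul_comp_le hc hd hs0' (hsum s hs0) (f := fun y => f y - p.eval y) (B := η)
    fun y hy => by rw [abs_sub_comm]; exact (hp y hy).le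
  obtain ⟨B, hB⟩ := isCompact_Icc.exists_bound_of_continuousOn
      (p.continuous.continuousOn (s := Set.Icc (0 : ℝ) 1))
  have hps := (abs_tsum_mul_comp_le hc hd hs0' (hsum s hs0) hB).1
  have heq : s ^ r * ∑' m, c m * exp (-(s * d m)) * f (exp (-(s * d m))) =
      s ^ r * (∑' m, c m * exp (-(s * d m)) * (f (exp (-(s * d m))) - p.eval (exp (-(s * d m))))) +
      s ^ r * ∑' m, c m * exp (-(s * d m)) * p.eval (exp (-(s * d m))) := by
    rw [← mul_add, ← hpb.1.tsum_add hps]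
    congr 2; funext m; ring
  have h4 : |s ^ r * (∑' m, c m * exp (-(s * d m)) *
      (f (exp (-(s * d m))) - p.eval (exp (-(s * d m)))))| ≤ η * (C + 1) := by
    rw [abs_mul, abs_of_nonneg (rpow_nonneg hs0'.le r)]
    calc _ ≤ s ^ r * (η * ∑' m, c m * exp (-(s * d m))) := by
          gcongr
          exact hpb.2
      _ = η * (s ^ r * ∑' m, c m * exp (-(s * d m))) := by ring
      _ ≤ _ := by gcongr
  have h5 : η * (2 * C + 3) = ε := by rw [hη]; field_simp
  rw [heq]
  rw [abs_le] at h3 h4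
  rw [abs_lt] at hs1 ⊢
  constructor <;> nlinarith

end Karamata

section KaramataSharp

variable {c d : ℕ → ℝ} {r C : ℝ}

/-- A continuous approximation of `y ↦ y⁻¹` cut off below `exp (-1)`. -/
noncomputable def smoothCutoff (t : ℝ) (n : ℕ) (y : ℝ) : ℝ :=
  (max y (exp (-2)))⁻¹ * max 0 (min 1 (t + n * (y - exp (-1))))

lemma continuous_smoothCutoff (t : ℝ) (n : ℕ) : Continuous (smoothCutoff t n) := by
  unfold smoothCutoff
  refine Continuous.mul (Continuous.inv₀ (by fun_prop) fun y => ?_) (by fun_prop)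
  exact (lt_max_of_lt_right (exp_pos _)).ne'

lemma smoothCutoff_nonneg (t : ℝ) (n : ℕ) (y : ℝ) : 0 ≤ smoothCutoff t n y :=
  mul_nonneg (inv_nonneg.mpr (le_max_of_le_right (exp_pos _).le)) (le_max_left _ _)

lemma smoothCutoff_le (t : ℝ) (n : ℕ) (y : ℝ) : smoothCutoff t n y ≤ exp 2 := by
  have h1 : (max y (exp (-2)))⁻¹ ≤ exp 2 := by
    rw [← inv_inv (exp 2), ← exp_neg]
    exact inv_anti₀ (exp_pos _) (le_max_right _ _)
  have h2 : max 0 (min 1 (t + n * (y - exp (-1)))) ≤ 1 := max_le zero_le_one (min_le_left _ _)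
  calc smoothCutoff t n y ≤ exp 2 * 1 :=
        mul_le_mul h1 h2 (le_max_left _ _) (exp_pos _).le
    _ = exp 2 := mul_one _

lemma exp_neg_mul_smoothCutoff_zero_le (n : ℕ) (u : ℝ) :
    exp (-u) * smoothCutoff 0 n (exp (-u)) ≤ if u ≤ 1 then 1 else 0 := by
  have h0 := exp_pos (-u)
  split_ifs with h
  · have h2 : max (exp (-u)) (exp (-2)) = exp (-u) := max_eq_left (exp_le_exp.mpr (by linarith))
    rw [smoothCutoff, h2, mul_inv_cancel_left₀ h0.ne']
    exact max_le zero_le_one (min_le_left _ _)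
  · have h1 : exp (-u) ≤ exp (-1) := exp_le_exp.mpr (by linarith)
    have h2 : max 0 (min 1 (0 + n * (exp (-u) - exp (-1)))) = 0 := by
      refine max_eq_left ((min_le_right _ _).trans ?_)
      have : (0 : ℝ) ≤ n := Nat.cast_nonneg n
      nlinarith
    rw [smoothCutoff, h2]; simp

lemma le_exp_neg_mul_smoothCutoff_one (n : ℕ) (u : ℝ) :
    (if u ≤ 1 then 1 else 0) ≤ exp (-u) * smoothCutoff 1 n (exp (-u)) := by
  have h0 := exp_pos (-u)
  split_ifs with h
  · have h1 : exp (-1) ≤ exp (-u) := exp_le_exp.mpr (by linarith)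
    have h2 : max (exp (-u)) (exp (-2)) = exp (-u) := max_eq_left (exp_le_exp.mpr (by linarith))
    rw [smoothCutoff, h2, mul_inv_cancel_left₀ h0.ne']
    refine le_max_of_le_right (le_min le_rfl ?_)
    have : (0 : ℝ) ≤ n := Nat.cast_nonneg n
    nlinarith
  · exact mul_nonneg h0.le (smoothCutoff_nonneg _ _ _)

lemma tendsto_exp_neg_mul_smoothCutoff (t : ℝ) {u : ℝ} (hu : u ≠ 1) :
    Tendsto (fun n => exp (-u) * smoothCutoff t n (exp (-u))) atTop
      (𝓝 (if u ≤ 1 then 1 else 0)) := by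
  have h0 := exp_pos (-u)
  refine tendsto_const_nhds.congr' ?_
  split_ifs with h
  · have h1 : exp (-1) < exp (-u) := exp_lt_exp.mpr (by grind)
    have h2 : max (exp (-u)) (exp (-2)) = exp (-u) := max_eq_left (exp_le_exp.mpr (by linarith))
    filter_upwards [(tendsto_natCast_atTop_atTop.atTop_mul_const (sub_pos.mpr h1)).eventually_ge_atTop
      (1 - t)] with n hn
    rw [smoothCutoff, h2, mul_inv_cancel_left₀ h0.ne', min_eq_left (by linarith),
      max_eq_right zero_le_one]
  · have h1 : 0 < exp (-1) - exp (-u) := sub_pos.mpr (exp_lt_exp.mpr (by linarith))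
    filter_upwards [(tendsto_natCast_atTop_atTop.atTop_mul_const h1).eventually_ge_atTop t]
      with n hn
    have h2 : max 0 (min 1 (t + n * (exp (-u) - exp (-1)))) = 0 :=
      max_eq_left ((min_le_right _ _).trans (by linarith))
    rw [smoothCutoff, h2]; simp

lemma tendsto_integral_smoothCutoff (hr : 0 < r) (t : ℝ) :
    Tendsto (fun n => ∫ u in Set.Ioi 0, exp (-u) * u ^ (r - 1) * smoothCutoff t n (exp (-u)))
      atTop (𝓝 r⁻¹) := by
  have e : ∫ u in Set.Ioi (0 : ℝ), (u ^ (r - 1) * if u ≤ 1 then 1 else 0) = r⁻¹ := by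
    have h1 : (fun u : ℝ => u ^ (r - 1) * if u ≤ 1 then 1 else 0) =
        (Set.Iic 1).indicator fun u : ℝ => u ^ (r - 1) := by
      funext u
      by_cases h : u ≤ 1 <;> simp [h, Set.indicator]
    rw [h1, setIntegral_indicator measurableSet_Iic, Set.Ioi_inter_Iic,
      ← intervalIntegral.integral_of_le zero_le_one, integral_rpow (Or.inl (by linarith))]
    simp [zero_rpow hr.ne']
  rw [← e]
  refine tendsto_integral_of_dominated_convergence (fun u => exp (-u) * u ^ (r - 1) * exp 2)
    (fun n => ?_) ((Real.GammaIntegral_convergent hr).mul_const _) (fun n => ?_) ?_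
  · refine (Real.GammaIntegral_convergent hr).aestronglyMeasurable.mul ?_
    exact ((continuous_smoothCutoff t n).comp (by fun_prop)).aestronglyMeasurable
  · refine (ae_restrict_iff' measurableSet_Ioi).mpr (Eventually.of_forall fun u hu => ?_)
    have hu' : 0 < u := hu
    have := smoothCutoff_nonneg t n (exp (-u))
    rw [norm_of_nonneg (by positivity)]
    gcongr
    exact smoothCutoff_le _ _ _
  · have h1 : ∀ᵐ u ∂(volume.restrict (Set.Ioi (0 : ℝ))), u ≠ 1 :=
      ae_restrict_of_ae (Measure.ae_ne volume 1)
    filter_upwards [h1] with u hu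
    refine ((tendsto_exp_neg_mul_smoothCutoff t hu).const_mul (u ^ (r - 1))).congr fun n => ?_
    ring

/-- **Karamata's Tauberian theorem** for Dirichlet-type series with nonnegative coefficients. -/
theorem tendsto_karamata (hr : 0 < r) (hc : ∀ m, 0 ≤ c m) (hd : ∀ m, 0 ≤ d m)
    (hsum : ∀ s > 0, Summable fun m => c m * exp (-(s * d m)))
    (hlim : Tendsto (fun s : ℝ => s ^ r * ∑' m, c m * exp (-(s * d m))) (𝓝[>] 0) (𝓝 C)) :
    Tendsto (fun s : ℝ => s ^ r * ∑' m, if s * d m ≤ 1 then c m else 0) (𝓝[>] 0)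
      (𝓝 (C / Gamma (r + 1))) := by
  have hG := Gamma_pos_of_pos hr
  have e : C / Gamma (r + 1) = C / Gamma r * r⁻¹ := by
    rw [Gamma_add_one hr.ne']; field_simp
  have hK := fun t n => tendsto_karamata_continuous hr hc hd hsum hlim (continuous_smoothCutoff t n)
  have hI := fun t => (tendsto_integral_smoothCutoff hr t).const_mul (C / Gamma r)
  have hS : ∀ t n, ∀ s > 0, Summable fun m =>
      c m * exp (-(s * d m)) * smoothCutoff t n (exp (-(s * d m))) := fun t n s hs =>
    (abs_tsum_mul_comp_le hc hd hs (hsum s hs) (f := smoothCutoff t n) (B := exp 2) fun y _ => by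
      rw [abs_of_nonneg (smoothCutoff_nonneg _ _ _)]; exact smoothCutoff_le _ _ _).1
  have hup : ∀ n s m, (if s * d m ≤ 1 then c m else 0) ≤
      c m * exp (-(s * d m)) * smoothCutoff 1 n (exp (-(s * d m))) := by
    intro n s m
    have := mul_le_mul_of_nonneg_left (le_exp_neg_mul_smoothCutoff_one n (s * d m)) (hc m)
    rw [mul_assoc]
    refine le_trans (le_of_eq ?_) this
    split_ifs <;> simp
  have hlo : ∀ n s m, c m * exp (-(s * d m)) * smoothCutoff 0 n (exp (-(s * d m))) ≤
      (if s * d m ≤ 1 then c m else 0) := by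
    intro n s m
    have := mul_le_mul_of_nonneg_left (exp_neg_mul_smoothCutoff_zero_le n (s * d m)) (hc m)
    rw [mul_assoc]
    refine this.trans (le_of_eq ?_)
    split_ifs <;> simp
  have hmid : ∀ s > 0, Summable fun m => if s * d m ≤ 1 then c m else 0 := fun s hs =>
    Summable.of_nonneg_of_le (fun m => by split_ifs <;> simp [hc m]) (hup 0 s) (hS 1 0 s hs)
  rw [e, tendsto_order]
  constructor
  · intro a ha
    obtain ⟨n, hn⟩ := ((hI 0).eventually (lt_mem_nhds ha)).exists
    filter_upwards [(hK 0 n).eventually (lt_mem_nhds hn), self_mem_nhdsWithin] with s hs hs0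
    refine hs.trans_le (mul_le_mul_of_nonneg_left ?_ (rpow_nonneg (Set.mem_Ioi.mp hs0).le r))
    exact (hS 0 n s hs0).tsum_le_tsum (hlo n s) (hmid s hs0)
  · intro a ha
    obtain ⟨n, hn⟩ := ((hI 1).eventually (gt_mem_nhds ha)).exists
    filter_upwards [(hK 1 n).eventually (gt_mem_nhds hn), self_mem_nhdsWithin] with s hs hs0
    refine lt_of_le_of_lt (mul_le_mul_of_nonneg_left ?_ (rpow_nonneg (Set.mem_Ioi.mp hs0).le r)) hs
    exact (hmid s hs0).tsum_le_tsum (hup n s) (hS 1 n s hs0)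

end KaramataSharp

section Loeschian

/-- A natural number is Loeschian if it is represented by the form `a ^ 2 + a * b + b ^ 2`. -/
def IsLoeschian (n : ℕ) : Prop := ∃ a b : ℤ, (n : ℤ) = a ^ 2 + a * b + b ^ 2

lemma IsLoeschian.mul {m n : ℕ} (hm : IsLoeschian m) (hn : IsLoeschian n) :
    IsLoeschian (m * n) := by
  obtain ⟨a, b, h⟩ := hm
  obtain ⟨c, d, h'⟩ := hn
  exact ⟨a * c - b * d, a * d + b * c + b * d, by push_cast; rw [h, h']; ring⟩

lemma isLoeschian_sq (n : ℕ) : IsLoeschian (n ^ 2) := ⟨n, 0, by push_cast; ring⟩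

lemma eq_zero_of_loeschianForm_eq_zero {p : ℕ} [Fact p.Prime] (hp : p % 3 = 2) {x y : ZMod p}
    (h : x ^ 2 + x * y + y ^ 2 = 0) : x = 0 ∧ y = 0 := by
  have hy : y = 0 := by
    by_contra hy
    set t := x / y with ht
    have h1 : t ^ 2 + t + 1 = 0 := by
      rw [ht]; field_simp; linear_combination h
    have h3 : t ^ 3 = 1 := by linear_combination (t - 1) * h1
    have ht0 : t ≠ 0 := by rintro h0; rw [h0] at h1; simp at h1
    have hpp : t ^ (p - 1) = 1 := ZMod.pow_card_sub_one_eq_one ht0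
    have ht1 : t = 1 := by
      have e : p - 1 = 3 * ((p - 1) / 3) + 1 := by omega
      rw [e, pow_succ, pow_mul, h3, one_pow, one_mul] at hpp
      exact hpp
    rw [ht1] at h1
    have h4 : ((3 : ℕ) : ZMod p) = 0 := by push_cast; linear_combination h1
    rw [ZMod.natCast_eq_zero_iff, Nat.prime_dvd_prime_iff_eq Fact.out Nat.prime_three] at h4
    omega
  subst hy
  simpa using h

lemma dvd_of_dvd_loeschianForm {p : ℕ} [Fact p.Prime] (hp : p % 3 = 2) {a b : ℤ}
    (h : (p : ℤ) ∣ a ^ 2 + a * b + b ^ 2) : (p : ℤ) ∣ a ∧ (p : ℤ) ∣ b := by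
  rw [← ZMod.intCast_zmod_eq_zero_iff_dvd] at h
  push_cast at h
  obtain ⟨h1, h2⟩ := eq_zero_of_loeschianForm_eq_zero hp h
  exact ⟨(ZMod.intCast_zmod_eq_zero_iff_dvd a p).mp h1, (ZMod.intCast_zmod_eq_zero_iff_dvd b p).mp h2⟩

lemma IsLoeschian.exists_eq_sq_mul {p n : ℕ} (hpp : p.Prime) (hp : p % 3 = 2)
    (hn : IsLoeschian n) (hd : p ∣ n) : ∃ m, n = p ^ 2 * m ∧ IsLoeschian m := by
  have := Fact.mk hpp
  obtain ⟨a, b, h⟩ := hn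
  obtain ⟨⟨a', rfl⟩, ⟨b', rfl⟩⟩ := dvd_of_dvd_loeschianForm hp (h ▸ Int.natCast_dvd_natCast.mpr hd)
  have h0 : 0 ≤ a' ^ 2 + a' * b' + b' ^ 2 := by nlinarith [sq_nonneg (a' + b'), sq_nonneg a', sq_nonneg b']
  obtain ⟨m, hm⟩ := Int.eq_ofNat_of_zero_le h0
  refine ⟨m, ?_, a', b', hm.symm⟩
  zify
  rw [h, ← hm]; ring

lemma IsLoeschian.even_factorization {p n : ℕ} (hpp : p.Prime) (hp : p % 3 = 2)
    (hn : IsLoeschian n) : Even (n.factorization p) := by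
  induction n using Nat.strong_induction_on with
  | _ n ih =>
    rcases Nat.eq_zero_or_pos n with rfl | hpos
    · simp
    by_cases hd : p ∣ n
    · obtain ⟨m, rfl, hm⟩ := hn.exists_eq_sq_mul hpp hp hd
      have hm0 : m ≠ 0 := by rintro rfl; simp at hpos
      have hlt : m < p ^ 2 * m := lt_mul_of_one_lt_left (Nat.pos_of_ne_zero hm0)
        (one_lt_pow₀ hpp.one_lt two_ne_zero)
      rw [Nat.factorization_mul (pow_ne_zero _ hpp.ne_zero) hm0, hpp.factorization_pow]
      simpa using Even.add even_two (ih m hlt hm)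
    · simp [Nat.factorization_eq_zero_of_not_dvd hd]

lemma exists_root_of_mod_three_eq_one {p : ℕ} [Fact p.Prime] (hp : p % 3 = 1) :
    ∃ t : ZMod p, t ^ 2 + t + 1 = 0 := by
  have h3 : 3 ∣ Fintype.card (ZMod p)ˣ := by rw [ZMod.card_units]; omega
  have := Fact.mk Nat.prime_three
  obtain ⟨g, hg⟩ := exists_prime_orderOf_dvd_card 3 h3
  refine ⟨g, ?_⟩
  have h1 : (g : ZMod p) ≠ 1 := by
    intro h
    have : g = 1 := Units.ext h
    rw [this, orderOf_one] at hg
    omega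
  have h2 : (g : ZMod p) ^ 3 = 1 := by
    rw [← Units.val_pow_eq_pow_val, ← hg, pow_orderOf_eq_one, Units.val_one]
  have : ((g : ZMod p) - 1) * ((g : ZMod p) ^ 2 + g + 1) = 0 := by linear_combination h2
  exact (mul_eq_zero.mp this).resolve_left (sub_ne_zero.mpr h1)

lemma isLoeschian_prime {p : ℕ} (hpp : p.Prime) (hp : p % 3 = 1) : IsLoeschian p := by
  have := Fact.mk hpp
  obtain ⟨t, ht⟩ := exists_root_of_mod_three_eq_one hp
  set k := p.sqrt with hk
  have hk1 : k * k < p := by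
    refine lt_of_le_of_ne (Nat.sqrt_le p) fun h => ?_
    have := hpp.two_le
    exact Nat.not_prime_mul (by grind) (by grind) (h ▸ hpp)
  have hk2 : p < (k + 1) * (k + 1) := Nat.lt_succ_sqrt p
  obtain ⟨⟨i, j⟩, h1, ⟨i', j'⟩, h2, hne, heq⟩ :=
    Finset.exists_ne_map_eq_of_card_lt_of_maps_to
      (s := Finset.range (k + 1) ×ˢ Finset.range (k + 1)) (t := (Finset.univ : Finset (ZMod p)))
      (f := fun z => (z.1 : ZMod p) - t * z.2)
      (by simpa [ZMod.card] using hk2) (fun _ _ => Finset.mem_univ _)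
  simp only [Finset.mem_product, Finset.mem_range] at h1 h2
  set x : ℤ := i - i' with hx
  set y : ℤ := j - j' with hy
  have hxy : (x : ZMod p) = t * y := by
    rw [hx, hy]; push_cast; linear_combination heq
  have hdvd : (p : ℤ) ∣ x ^ 2 + x * y + y ^ 2 := by
    rw [← ZMod.intCast_zmod_eq_zero_iff_dvd]
    push_cast
    rw [hxy]; linear_combination (y : ZMod p) ^ 2 * ht
  have hne0 : x ≠ 0 ∨ y ≠ 0 := by
    by_contra! h
    apply hne
    ext <;> simp <;> omega
  have hpos : 0 < x ^ 2 + x * y + y ^ 2 := by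
    rcases hne0 with h | h
    · nlinarith [sq_nonneg (x + 2 * y), sq_pos_of_ne_zero h]
    · nlinarith [sq_nonneg (2 * x + y), sq_pos_of_ne_zero h]
  have hxk : x ^ 2 ≤ k * k := by nlinarith [show -(k : ℤ) ≤ x by omega, show x ≤ k by omega]
  have hyk : y ^ 2 ≤ k * k := by nlinarith [show -(k : ℤ) ≤ y by omega, show y ≤ k by omega]
  have hlt : x ^ 2 + x * y + y ^ 2 < 3 * p := by
    have : (k : ℤ) * k < p := by exact_mod_cast hk1
    nlinarith [sq_nonneg (x - y)]
  obtain ⟨c, hc⟩ := hdvd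
  have hp0 : (0 : ℤ) < p := by exact_mod_cast hpp.pos
  have hc0 : 0 < c := by
    rw [hc] at hpos
    exact pos_of_mul_pos_right hpos hp0.le
  have hc3 : c < 3 := by
    rw [hc, mul_comm] at hlt
    exact lt_of_mul_lt_mul_right hlt hp0.le
  obtain rfl | rfl : c = 1 ∨ c = 2 := by omega
  · exact ⟨x, y, by rw [hc, mul_one]⟩
  · exfalso
    have := Fact.mk Nat.prime_two
    obtain ⟨⟨a, ha⟩, ⟨b, hb⟩⟩ := dvd_of_dvd_loeschianForm (p := 2) rfl
      (Dvd.intro_left (p : ℤ) hc.symm)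
    have h4 : (p : ℤ) = 2 * (a ^ 2 + a * b + b ^ 2) := by
      rw [ha, hb] at hc
      push_cast at hc
      linarith
    have : 2 ∣ p := by exact_mod_cast Dvd.intro _ h4.symm
    rw [Nat.prime_dvd_prime_iff_eq Nat.prime_two hpp] at this
    omega

lemma isLoeschian_of_even_factorization {n : ℕ} (hn : n ≠ 0)
    (h : ∀ p, p.Prime → p % 3 = 2 → Even (n.factorization p)) : IsLoeschian n := by
  induction n using Nat.strong_induction_on with
  | _ n ih =>
    rcases eq_or_ne n 1 with rfl | h1
    · exact isLoeschian_sq 1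
    obtain ⟨p, hpp, hd⟩ := Nat.exists_prime_and_dvd h1
    have key : ∀ e, Even e ∨ p % 3 ≠ 2 → e ≠ 0 → p ^ e ∣ n → IsLoeschian (p ^ e) → IsLoeschian n := by
      rintro e he he0 ⟨m, rfl⟩ hl
      have hm0 : m ≠ 0 := by rintro rfl; simp at hn
      have hlt : m < p ^ e * m := lt_mul_of_one_lt_left (Nat.pos_of_ne_zero hm0)
        (one_lt_pow₀ hpp.one_lt he0)
      refine hl.mul (ih m hlt hm0 fun q hq hq3 => ?_)
      have := h q hq hq3
      rw [Nat.factorization_mul (pow_ne_zero _ hpp.ne_zero) hm0, hpp.factorization_pow,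
        Finsupp.add_apply, Finsupp.single_apply] at this
      split_ifs at this with hpq
      · subst hpq
        exact (Nat.even_add.mp this).mp (he.resolve_right (not_not.mpr hq3))
      · simpa using this
    by_cases hp : p % 3 = 2
    · have h2 : 2 ≤ n.factorization p := by
        have h3 := h p hpp hp
        have h4 := hpp.factorization_pos_of_dvd hn hd
        obtain ⟨k, hk⟩ := h3
        omega
      exact key 2 (Or.inl even_two) two_ne_zero ((hpp.pow_dvd_iff_le_factorization hn).mpr h2)
        (isLoeschian_sq p)
    · refine key 1 (Or.inr hp) one_ne_zero (by simpa using hd) ?_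
      rw [pow_one]
      by_cases hp1 : p % 3 = 1
      · exact isLoeschian_prime hpp hp1
      · have : 3 ∣ p := by omega
        rw [Nat.prime_dvd_prime_iff_eq Nat.prime_three hpp] at this
        exact ⟨1, 1, by rw [← this]; norm_num⟩

theorem isLoeschian_iff {n : ℕ} (hn : n ≠ 0) :
    IsLoeschian n ↔ ∀ p, p.Prime → p % 3 = 2 → Even (n.factorization p) :=
  ⟨fun h _ hpp hp => h.even_factorization hpp hp, isLoeschian_of_even_factorization hn⟩

end Loeschian

section LoeschianMangoldt

open Classical in
/-- The indicator function of the positive Loeschian numbers. -/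
noncomputable def loeschianInd : ArithmeticFunction ℝ :=
  ⟨fun n => if n ≠ 0 ∧ IsLoeschian n then 1 else 0, by simp⟩

lemma loeschianInd_apply_of_isLoeschian {n : ℕ} (hn : n ≠ 0) (h : IsLoeschian n) :
    loeschianInd n = 1 := if_pos ⟨hn, h⟩

lemma loeschianInd_apply_of_not_isLoeschian {n : ℕ} (h : ¬ IsLoeschian n) :
    loeschianInd n = 0 := if_neg fun h' => h h'.2

lemma loeschianInd_nonneg (n : ℕ) : 0 ≤ loeschianInd n := by
  by_cases h : n ≠ 0 ∧ IsLoeschian n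
  · exact zero_le_one.trans_eq (if_pos h).symm
  · exact (if_neg h).ge

lemma loeschianInd_le_one (n : ℕ) : loeschianInd n ≤ 1 := by
  by_cases h : n ≠ 0 ∧ IsLoeschian n
  · exact (if_pos h).le
  · exact (if_neg h).trans_le zero_le_one

lemma loeschianInd_congr {m n : ℕ} (hm : m ≠ 0) (hn : n ≠ 0) (h : IsLoeschian m ↔ IsLoeschian n) :
    loeschianInd m = loeschianInd n := by
  by_cases hl : IsLoeschian m
  · rw [loeschianInd_apply_of_isLoeschian hm hl, loeschianInd_apply_of_isLoeschian hn (h.mp hl)]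
  · rw [loeschianInd_apply_of_not_isLoeschian hl,
      loeschianInd_apply_of_not_isLoeschian (mt h.mpr hl)]

/-- The analogue of the von Mangoldt function for the Dirichlet series of `loeschianInd`. -/
noncomputable def loeschianMangoldt : ArithmeticFunction ℝ :=
  ⟨fun n => if n.minFac % 3 = 2 then (if n % 3 = 1 then 2 * vonMangoldt n else 0)
    else vonMangoldt n, by simp⟩

lemma loeschianMangoldt_apply (n : ℕ) : loeschianMangoldt n =
    if n.minFac % 3 = 2 then (if n % 3 = 1 then 2 * vonMangoldt n else 0) else vonMangoldt n := rfl

lemma loeschianMangoldt_nonneg (n : ℕ) : 0 ≤ loeschianMangoldt n := by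
  have : 0 ≤ vonMangoldt n := ArithmeticFunction.vonMangoldt_nonneg
  rw [loeschianMangoldt_apply]
  split_ifs <;> positivity

lemma isPrimePow_of_loeschianMangoldt_ne_zero {n : ℕ} (h : loeschianMangoldt n ≠ 0) :
    IsPrimePow n := by
  by_contra hn
  rw [loeschianMangoldt_apply, ArithmeticFunction.vonMangoldt_eq_zero_iff.mpr hn] at h
  simp at h

lemma pow_mod_three_eq_one_iff {p k : ℕ} (hp : p % 3 = 2) : p ^ k % 3 = 1 ↔ Even k := by
  rw [Nat.pow_mod, hp]
  rcases Nat.even_or_odd' k with ⟨j, rfl | rfl⟩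
  · simp [pow_mul, Nat.pow_mod]
  · simp [pow_succ, pow_mul, Nat.mul_mod, Nat.pow_mod]

lemma loeschianMangoldt_apply_pow {p k : ℕ} (hp : p.Prime) (hk : k ≠ 0) :
    loeschianMangoldt (p ^ k) =
      if p % 3 = 2 then (if Even k then 2 * log p else 0) else log p := by
  rw [loeschianMangoldt_apply, hp.pow_minFac hk, ArithmeticFunction.vonMangoldt_apply_pow hk,
    ArithmeticFunction.vonMangoldt_apply_prime hp]
  by_cases h : p % 3 = 2
  · simp only [pow_mod_three_eq_one_iff h]
  · simp [h]

lemma isLoeschian_mul_iff_of_coprime {a b : ℕ} (ha : a ≠ 0) (hb : b ≠ 0) (hab : a.Coprime b) :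
    IsLoeschian (a * b) ↔ IsLoeschian a ∧ IsLoeschian b := by
  refine ⟨fun h => ?_, fun h => h.1.mul h.2⟩
  rw [isLoeschian_iff (mul_ne_zero ha hb)] at h
  rw [isLoeschian_iff ha, isLoeschian_iff hb, ← forall_and]
  intro p
  rw [← imp_and]
  intro hp
  rw [← imp_and]
  intro hp3
  have := h p hp hp3
  rw [Nat.factorization_mul ha hb, Finsupp.add_apply] at this
  by_cases hd : p ∣ a
  · have : ¬ p ∣ b := fun hd' => hp.one_lt.ne' (Nat.eq_one_of_dvd_coprimes hab hd hd')
    simp_all [Nat.factorization_eq_zero_of_not_dvd]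
  · simp_all [Nat.factorization_eq_zero_of_not_dvd]

lemma isLoeschian_prime_pow_iff {p k : ℕ} (hp : p.Prime) :
    IsLoeschian (p ^ k) ↔ (p % 3 = 2 → Even k) := by
  rw [isLoeschian_iff (pow_ne_zero _ hp.ne_zero)]
  constructor
  · intro h hp3
    simpa [hp.factorization_pow] using h p hp hp3
  · intro h q hq hq3
    rw [hp.factorization_pow, Finsupp.single_apply]
    split_ifs with hpq
    · exact h (hpq ▸ hq3)
    · exact Even.zero

lemma isLoeschian_prime_pow_mul_iff {p k m : ℕ} (hp : p.Prime) (hm : m ≠ 0)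
    (h : p % 3 = 2 → Even k) : IsLoeschian (p ^ k * m) ↔ IsLoeschian m := by
  refine ⟨fun h' => ?_, fun h' => ((isLoeschian_prime_pow_iff hp).mpr h).mul h'⟩
  rw [isLoeschian_iff (mul_ne_zero (pow_ne_zero _ hp.ne_zero) hm)] at h'
  rw [isLoeschian_iff hm]
  intro q hq hq3
  have := h' q hq hq3
  rw [Nat.factorization_mul (pow_ne_zero _ hp.ne_zero) hm, hp.factorization_pow,
    Finsupp.add_apply, Finsupp.single_apply] at this
  split_ifs at this with hpq
  · exact (Nat.even_add.mp this).mp (h (hpq ▸ hq3))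
  · simpa using this

lemma sum_divisors_loeschianMangoldt {n : ℕ} (h0 : n ≠ 0) (hn : IsLoeschian n) :
    ∑ d ∈ n.divisors, loeschianMangoldt d = log n := by
  induction n using Nat.recOnPrimeCoprime with
  | zero => simp at h0
  | prime_pow p k hp =>
    rw [isLoeschian_prime_pow_iff hp] at hn
    rw [Nat.sum_divisors_prime_pow hp, Nat.cast_pow, Real.log_pow, Finset.sum_range_succ', pow_zero]
    have h1 : loeschianMangoldt 1 = 0 := by simp [loeschianMangoldt_apply]
    simp only [loeschianMangoldt_apply_pow hp (Nat.succ_ne_zero _), h1, add_zero]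
    by_cases h : p % 3 = 2
    · obtain ⟨j, rfl⟩ := hn h
      simp only [h, if_true]
      clear hn h0
      induction j with
      | zero => simp
      | succ j ih =>
        rw [show j + 1 + (j + 1) = j + j + 1 + 1 by ring, Finset.sum_range_succ,
          Finset.sum_range_succ, ih, if_neg (by grind), if_pos (by grind)]
        push_cast; ring
    · simp [h]
  | coprime a b ha hb hab iha ihb =>
    have ha0 : a ≠ 0 := by omega
    have hb0 : b ≠ 0 := by omega
    obtain ⟨hla, hlb⟩ := (isLoeschian_mul_iff_of_coprime ha0 hb0 hab).mp hn
    have key : ∀ s : Finset ℕ, ∑ d ∈ s with IsPrimePow d, loeschianMangoldt d =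
        ∑ d ∈ s, loeschianMangoldt d := fun s =>
      Finset.sum_filter_of_ne fun d _ => isPrimePow_of_loeschianMangoldt_ne_zero
    have iha := iha ha0 hla
    have ihb := ihb hb0 hlb
    rw [← key] at iha ihb ⊢
    rw [Nat.mul_divisors_filter_prime_pow hab, Finset.filter_union,
      Finset.sum_union (Nat.disjoint_divisors_filter_isPrimePow hab), iha, ihb, Nat.cast_mul,
      Real.log_mul (by exact_mod_cast ha0) (by exact_mod_cast hb0)]

theorem loeschianInd_mul_loeschianMangoldt (n : ℕ) :
    (loeschianInd * loeschianMangoldt) n = loeschianInd n * log n := by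
  rcases eq_or_ne n 0 with rfl | hn
  · simp
  have h1 : ∀ z ∈ n.divisorsAntidiagonal,
      loeschianInd z.1 * loeschianMangoldt z.2 = loeschianInd n * loeschianMangoldt z.2 := by
    rintro ⟨m, d⟩ hz
    obtain ⟨rfl, -⟩ := Nat.mem_divisorsAntidiagonal.mp hz
    rcases eq_or_ne (loeschianMangoldt d) 0 with h | h
    · simp [h]
    obtain ⟨p, k, hp, hk, rfl⟩ := (isPrimePow_nat_iff _).mp (isPrimePow_of_loeschianMangoldt_ne_zero h)
    rw [loeschianMangoldt_apply_pow hp hk.ne'] at h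
    have hk' : p % 3 = 2 → Even k := by
      intro h3
      by_contra h4
      simp [h3, h4] at h
    have hm : m ≠ 0 := left_ne_zero_of_mul hn
    congr 1
    refine loeschianInd_congr hm hn ?_
    rw [mul_comm]
    exact (isLoeschian_prime_pow_mul_iff hp hm hk').symm
  rw [ArithmeticFunction.mul_apply, Finset.sum_congr rfl h1, ← Finset.mul_sum,
    Nat.sum_divisorsAntidiagonal' (f := fun _ d => loeschianMangoldt d)]
  by_cases h : IsLoeschian n
  · rw [sum_divisors_loeschianMangoldt hn h]
  · rw [loeschianInd_apply_of_not_isLoeschian h, zero_mul, zero_mul]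

end LoeschianMangoldt

section LoeschianChebyshev

/-- The summatory function of `loeschianMangoldt`. -/
noncomputable def loeschianPsi (x : ℝ) : ℝ := ∑ n ∈ Finset.Ioc 0 ⌊x⌋₊, loeschianMangoldt n

lemma loeschianMangoldt_sub_residueClass_bounds (n : ℕ) :
    0 ≤ loeschianMangoldt n - vonMangoldt.residueClass (1 : ZMod 3) n ∧
    loeschianMangoldt n - vonMangoldt.residueClass (1 : ZMod 3) n ≤
      (if n.Prime then 0 else vonMangoldt n) + if n = 3 then log 3 else 0 := by
  have hlog : 0 ≤ log 3 := log_nonneg (by norm_num)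
  have hΛ : 0 ≤ vonMangoldt n := ArithmeticFunction.vonMangoldt_nonneg
  have hres : vonMangoldt.residueClass (1 : ZMod 3) n = if n % 3 = 1 then vonMangoldt n else 0 := by
    have : (n : ZMod 3) = 1 ↔ n % 3 = 1 := by
      rw [← Nat.cast_one, ZMod.natCast_eq_natCast_iff']
    simp only [vonMangoldt.residueClass, Set.indicator_apply, Set.mem_ofPred_eq, this]
  rw [hres]
  by_cases hpp : IsPrimePow n
  swap
  · have h0 : vonMangoldt n = 0 := ArithmeticFunction.vonMangoldt_eq_zero_iff.mpr hpp
    rw [loeschianMangoldt_apply, h0]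
    simp only [mul_zero, ite_self, sub_zero, le_refl, zero_add, true_and]
    split_ifs <;> simp [hlog]
  obtain ⟨p, k, hp, hk, rfl⟩ := (isPrimePow_nat_iff _).mp hpp
  rw [loeschianMangoldt_apply, hp.pow_minFac hk.ne']
  rcases (by omega : p % 3 = 0 ∨ p % 3 = 1 ∨ p % 3 = 2) with h | h | h
  · have hp3 : 3 = p := (Nat.prime_dvd_prime_iff_eq Nat.prime_three hp).mp (Nat.dvd_of_mod_eq_zero h)
    subst hp3
    have h3 : ¬ 3 ^ k % 3 = 1 := by
      obtain ⟨j, rfl⟩ := Nat.exists_eq_succ_of_ne_zero hk.ne'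
      rw [pow_succ, Nat.mul_mod_left]; simp
    rw [if_neg (by simp), if_neg h3, sub_zero]
    refine ⟨hΛ, ?_⟩
    by_cases hk1 : k = 1
    · subst hk1
      simp [ArithmeticFunction.vonMangoldt_apply_prime Nat.prime_three, Nat.prime_three]
    · rw [if_neg (Nat.Prime.not_prime_pow' hk1)]
      split_ifs <;> linarith
  · have h1 : p ^ k % 3 = 1 := by rw [Nat.pow_mod, h]; simp
    rw [if_neg (by omega), if_pos h1, sub_self]
    refine ⟨le_rfl, ?_⟩
    split_ifs <;> linarith
  · rw [if_pos h]
    by_cases hk2 : p ^ k % 3 = 1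
    · rw [if_pos hk2, if_pos hk2]
      refine ⟨by linarith, ?_⟩
      have : ¬ (p ^ k).Prime := Nat.Prime.not_prime_pow' (by
        rintro rfl; rw [pow_one] at hk2; omega)
      rw [if_neg this]
      split_ifs <;> linarith
    · rw [if_neg hk2, if_neg hk2, sub_self]
      refine ⟨le_rfl, ?_⟩
      split_ifs <;> linarith

theorem tendsto_loeschianPsi : Tendsto (fun x => loeschianPsi x / x) atTop (𝓝 2⁻¹) := by
  obtain ⟨K, hK⟩ := Chebyshev.psi_sub_theta_le_mul_sqrt
  have h1 := tendsto_sum_residueClass (q := 3) (a := 1) isUnit_one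
  have h2 : Tendsto (fun x : ℝ => K * √x / x + log 3 / x) atTop (𝓝 0) := by
    have e1 : Tendsto (fun x : ℝ => K * (√x)⁻¹) atTop (𝓝 (K * 0)) :=
      (tendsto_inv_atTop_zero.comp tendsto_sqrt_atTop).const_mul K
    have e2 : Tendsto (fun x : ℝ => log 3 / x) atTop (𝓝 0) := tendsto_const_nhds.div_atTop tendsto_id
    have := e1.add e2
    rw [mul_zero, add_zero] at this
    refine this.congr' ?_
    filter_upwards [eventually_gt_atTop 0] with x hx
    have := sq_sqrt hx.le
    have hs := (sqrt_pos.mpr hx).ne'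
    congr 1
    rw [inv_eq_one_div, mul_one_div, div_eq_div_iff hs hx.ne', mul_assoc, mul_self_sqrt hx.le]
  have h3 : Tendsto (fun x : ℝ => (∑ n ∈ Finset.Icc 1 ⌊x⌋₊,
      (loeschianMangoldt n - vonMangoldt.residueClass (1 : ZMod 3) n)) / x) atTop (𝓝 0) := by
    refine tendsto_of_tendsto_of_tendsto_of_le_of_le' tendsto_const_nhds h2 ?_ ?_
    · filter_upwards [eventually_gt_atTop 0] with x hx
      exact div_nonneg (Finset.sum_nonneg fun n _ => (loeschianMangoldt_sub_residueClass_bounds n).1)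
        hx.le
    · filter_upwards [eventually_gt_atTop 0] with x hx
      rw [← add_div]
      gcongr
      calc _ ≤ ∑ n ∈ Finset.Icc 1 ⌊x⌋₊, ((if n.Prime then 0 else vonMangoldt n) +
              if n = 3 then log 3 else 0) :=
            Finset.sum_le_sum fun n _ => (loeschianMangoldt_sub_residueClass_bounds n).2
        _ ≤ K * √x + log 3 := by
            rw [Finset.sum_add_distrib]
            refine add_le_add ?_ ?_
            · refine le_trans (le_of_eq ?_) (hK x)
              rw [Chebyshev.psi_sub_theta_eq_sum_not_prime, Finset.sum_filter]
              refine Finset.sum_congr rfl fun n _ => ?_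
              split_ifs <;> rfl
            · rw [Finset.sum_ite_eq']
              have : 0 ≤ log 3 := log_nonneg (by norm_num)
              split_ifs <;> simp [this]
  have h4 := h1.add h3
  have e : ((Nat.totient 3 : ℕ) : ℝ)⁻¹ + 0 = 2⁻¹ := by
    rw [Nat.totient_prime Nat.prime_three]; norm_num
  rw [e] at h4
  refine h4.congr fun x => ?_
  rw [← add_div, ← Finset.sum_add_distrib, loeschianPsi]
  congr 1
  refine Finset.sum_congr rfl fun n _ => ?_
  ring

lemma exists_abs_loeschianPsi_sub_le {ε : ℝ} (hε : 0 < ε) :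
    ∃ K, 0 ≤ K ∧ ∀ y, 0 ≤ y → |loeschianPsi y - y / 2| ≤ ε * y + K := by
  obtain ⟨Y, hY⟩ := eventually_atTop.mp (Metric.tendsto_nhds.mp tendsto_loeschianPsi ε hε)
  have hnn : ∀ y, 0 ≤ loeschianPsi y := fun y =>
    Finset.sum_nonneg fun n _ => loeschianMangoldt_nonneg n
  have hmono : Monotone loeschianPsi := fun x y hxy =>
    Finset.sum_le_sum_of_subset_of_nonneg
      (Finset.Ioc_subset_Ioc_right (Nat.floor_mono hxy)) fun n _ _ => loeschianMangoldt_nonneg n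
  refine ⟨loeschianPsi Y + |Y|, add_nonneg (hnn Y) (abs_nonneg _), fun y hy => ?_⟩
  rcases hy.eq_or_lt with rfl | hy0
  · simpa [loeschianPsi] using add_nonneg (hnn Y) (abs_nonneg _)
  by_cases h : Y ≤ y
  · have h1 := hY y h
    rw [Real.dist_eq] at h1
    have h2 : loeschianPsi y - y / 2 = (loeschianPsi y / y - 2⁻¹) * y := by field_simp
    rw [h2, abs_mul, abs_of_pos hy0]
    have := mul_le_mul_of_nonneg_right h1.le hy
    linarith [add_nonneg (hnn Y) (abs_nonneg Y)]
  · have h1 := hmono (not_le.mp h).le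
    have h2 := hnn y
    have h3 := le_abs_self Y
    rw [abs_le]
    have := mul_pos hε hy0
    constructor <;> linarith

end LoeschianChebyshev

section LoeschianCount

/-- The number of positive Loeschian numbers up to `x`. -/
noncomputable def loeschianCount (x : ℝ) : ℝ := ∑ n ∈ Finset.Ioc 0 ⌊x⌋₊, loeschianInd n

/-- The sum of the reciprocals of the positive Loeschian numbers up to `x`. -/
noncomputable def loeschianRecip (x : ℝ) : ℝ := ∑ n ∈ Finset.Ioc 0 ⌊x⌋₊, loeschianInd n / n

lemma loeschianRecip_nonneg (x : ℝ) : 0 ≤ loeschianRecip x :=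
  Finset.sum_nonneg fun n _ => div_nonneg (loeschianInd_nonneg n) n.cast_nonneg

lemma loeschianCount_le {x : ℝ} (hx : 0 ≤ x) : loeschianCount x ≤ x := by
  calc loeschianCount x ≤ ∑ n ∈ Finset.Ioc 0 ⌊x⌋₊, (1 : ℝ) :=
        Finset.sum_le_sum fun n _ => loeschianInd_le_one n
    _ = ⌊x⌋₊ := by simp
    _ ≤ x := Nat.floor_le hx

lemma sum_inv_sqrt_le (N : ℕ) : ∑ n ∈ Finset.Ioc 0 N, (√(n : ℝ))⁻¹ ≤ 2 * √(N : ℝ) := by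
  induction N with
  | zero => simp
  | succ N ih =>
    rw [← Finset.insert_Ioc_right_eq_Ioc_add_one (Nat.zero_le N), Finset.sum_insert (by simp)]
    set a := √(N : ℝ)
    set b := √((N + 1 : ℕ) : ℝ)
    have ha : 0 ≤ a := sqrt_nonneg _
    have hb : 0 < b := sqrt_pos.mpr (by positivity)
    have h1 : a ^ 2 = N := sq_sqrt (by positivity)
    have h2 : b ^ 2 = N + 1 := by rw [sq_sqrt (by positivity)]; push_cast; ring
    have h3 : b⁻¹ ≤ 2 * b - 2 * a := by
      rw [inv_le_iff_one_le_mul₀ hb]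
      nlinarith [sq_nonneg (a - b)]
    linarith

lemma sum_log_div_le {x : ℝ} (hx : 0 ≤ x) :
    ∑ n ∈ Finset.Ioc 0 ⌊x⌋₊, log (x / n) ≤ 4 * x := by
  have h : ∀ n ∈ Finset.Ioc 0 ⌊x⌋₊, log (x / n) ≤ 2 * √x * (√(n : ℝ))⁻¹ := by
    intro n hn
    have hn0 : (0 : ℝ) < n := by exact_mod_cast (Finset.mem_Ioc.mp hn).1
    have h1 : 0 ≤ x / n := by positivity
    have h2 : log (x / n) = 2 * log √(x / n) := by rw [log_sqrt h1]; ring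
    rw [h2, mul_assoc, ← div_eq_mul_inv, ← sqrt_div hx]
    have := log_le_self (sqrt_nonneg (x / n))
    linarith
  calc _ ≤ ∑ n ∈ Finset.Ioc 0 ⌊x⌋₊, 2 * √x * (√(n : ℝ))⁻¹ := Finset.sum_le_sum h
    _ = 2 * √x * ∑ n ∈ Finset.Ioc 0 ⌊x⌋₊, (√(n : ℝ))⁻¹ := by rw [Finset.mul_sum]
    _ ≤ 2 * √x * (2 * √x) := by
        gcongr
        refine (sum_inv_sqrt_le _).trans ?_
        gcongr
        exact Nat.floor_le hx
    _ = 4 * x := by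
        have := mul_self_sqrt hx
        linear_combination 4 * this

lemma abs_loeschianCount_mul_log_sub_le {ε : ℝ} (hε : 0 < ε) : ∃ K, 0 ≤ K ∧ ∀ x, 1 ≤ x →
    |loeschianCount x * log x - x / 2 * loeschianRecip x| ≤
      ε * (x * loeschianRecip x) + (K + 4) * x := by
  obtain ⟨K, hK0, hK⟩ := exists_abs_loeschianPsi_sub_le hε
  refine ⟨K, hK0, fun x hx => ?_⟩
  have hx0 : 0 ≤ x := by linarith
  have h1 : ∑ n ∈ Finset.Ioc 0 ⌊x⌋₊, loeschianInd n * log n =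
      ∑ n ∈ Finset.Ioc 0 ⌊x⌋₊, loeschianInd n * loeschianPsi (x / n) := by
    have := ArithmeticFunction.sum_Ioc_mul_eq_sum_sum loeschianInd loeschianMangoldt ⌊x⌋₊
    simp only [loeschianInd_mul_loeschianMangoldt] at this
    rw [this]
    refine Finset.sum_congr rfl fun n _ => ?_
    rw [loeschianPsi, Nat.floor_div_natCast]
  have h2 : |∑ n ∈ Finset.Ioc 0 ⌊x⌋₊, loeschianInd n * (loeschianPsi (x / n) - x / n / 2)| ≤
      ε * (x * loeschianRecip x) + K * x := by
    calc _ ≤ ∑ n ∈ Finset.Ioc 0 ⌊x⌋₊, |loeschianInd n * (loeschianPsi (x / n) - x / n / 2)| :=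
          Finset.abs_sum_le_sum_abs _ _
      _ ≤ ∑ n ∈ Finset.Ioc 0 ⌊x⌋₊, loeschianInd n * (ε * (x / n) + K) := by
          refine Finset.sum_le_sum fun n _ => ?_
          rw [abs_mul, abs_of_nonneg (loeschianInd_nonneg n)]
          exact mul_le_mul_of_nonneg_left (hK _ (by positivity)) (loeschianInd_nonneg n)
      _ = ε * (x * loeschianRecip x) + K * loeschianCount x := by
          simp only [loeschianRecip, loeschianCount, Finset.mul_sum, ← Finset.sum_add_distrib]
          refine Finset.sum_congr rfl fun n _ => ?_
          ring
      _ ≤ _ := by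
          gcongr
          exact loeschianCount_le hx0
  have h3 : 0 ≤ ∑ n ∈ Finset.Ioc 0 ⌊x⌋₊, loeschianInd n * log (x / n) ∧
      ∑ n ∈ Finset.Ioc 0 ⌊x⌋₊, loeschianInd n * log (x / n) ≤ 4 * x := by
    have hl : ∀ n ∈ Finset.Ioc 0 ⌊x⌋₊, 0 ≤ log (x / n) := by
      intro n hn
      obtain ⟨hn0, hn1⟩ := Finset.mem_Ioc.mp hn
      have : (n : ℝ) ≤ x := (Nat.le_floor_iff hx0).mp hn1
      exact log_nonneg ((one_le_div (by exact_mod_cast hn0)).mpr this)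
    refine ⟨Finset.sum_nonneg fun n hn => mul_nonneg (loeschianInd_nonneg n) (hl n hn), ?_⟩
    refine le_trans (Finset.sum_le_sum fun n hn => ?_) (sum_log_div_le hx0)
    exact mul_le_of_le_one_left (hl n hn) (loeschianInd_le_one n)
  have h4 : loeschianCount x * log x - x / 2 * loeschianRecip x =
      ∑ n ∈ Finset.Ioc 0 ⌊x⌋₊, loeschianInd n * log (x / n) +
      ∑ n ∈ Finset.Ioc 0 ⌊x⌋₊, loeschianInd n * (loeschianPsi (x / n) - x / n / 2) := by
    simp only [mul_sub, Finset.sum_sub_distrib]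
    rw [← h1, ← add_sub_assoc, ← Finset.sum_add_distrib, loeschianCount, loeschianRecip,
      Finset.sum_mul, Finset.mul_sum]
    congr 1
    · refine Finset.sum_congr rfl fun n hn => ?_
      have : (n : ℝ) ≠ 0 := by exact_mod_cast (Finset.mem_Ioc.mp hn).1.ne'
      rw [log_div (by linarith) this]; ring
    · refine Finset.sum_congr rfl fun n _ => ?_
      ring
  rw [h4]
  rw [abs_le] at h2 ⊢
  constructor <;> linarith [h2.1, h2.2, h3.1, h3.2]

theorem tendsto_loeschianCount_of_loeschianRecip {β : ℝ}
    (h : Tendsto (fun x => loeschianRecip x / √(log x)) atTop (𝓝 β)) :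
    Tendsto (fun x => loeschianCount x * √(log x) / x) atTop (𝓝 (β / 2)) := by
  suffices hz : Tendsto (fun x => loeschianCount x * √(log x) / x -
      (loeschianRecip x / √(log x)) / 2) atTop (𝓝 0) by
    have := hz.add (h.div_const 2)
    rw [zero_add] at this
    exact this.congr fun x => by ring
  have hβ : 0 ≤ β := ge_of_tendsto' h fun x => div_nonneg (loeschianRecip_nonneg x) (sqrt_nonneg _)
  rw [Metric.tendsto_nhds]
  intro ε hε
  obtain ⟨K, hK0, hK⟩ := abs_loeschianCount_mul_log_sub_le (ε := ε / (2 * (β + 1))) (by positivity)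
  have h1 : Tendsto (fun x => (K + 4) / √(log x)) atTop (𝓝 0) :=
    tendsto_const_nhds.div_atTop (tendsto_sqrt_atTop.comp tendsto_log_atTop)
  filter_upwards [h1.eventually (gt_mem_nhds (half_pos hε)),
    h.eventually (gt_mem_nhds (lt_add_one β)), eventually_gt_atTop 1] with x hx1 hx2 hx3
  rw [Real.dist_eq, sub_zero]
  have hL : 0 < log x := log_pos hx3
  have hs : 0 < √(log x) := sqrt_pos.mpr hL
  have hss : √(log x) * √(log x) = log x := mul_self_sqrt hL.le
  have hx0 : 0 < x := by linarith
  have e : loeschianCount x * √(log x) / x - (loeschianRecip x / √(log x)) / 2 =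
      (loeschianCount x * log x - x / 2 * loeschianRecip x) / (x * √(log x)) := by
    generalize √(log x) = t at hs hss ⊢
    rw [← hss]
    field_simp
  rw [e, abs_div, abs_of_pos (mul_pos hx0 hs), div_lt_iff₀ (mul_pos hx0 hs)]
  refine (hK x hx3.le).trans_lt ?_
  have e1 : ε / (2 * (β + 1)) * (x * loeschianRecip x) + (K + 4) * x =
      (ε / (2 * (β + 1)) * (loeschianRecip x / √(log x)) + (K + 4) / √(log x)) *
        (x * √(log x)) := by field_simp
  rw [e1]
  refine mul_lt_mul_of_pos_right ?_ (mul_pos hx0 hs)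
  have h2 : ε / (2 * (β + 1)) * (loeschianRecip x / √(log x)) ≤ ε / (2 * (β + 1)) * (β + 1) := by
    gcongr
  have h3 : ε / (2 * (β + 1)) * (β + 1) = ε / 2 := by field_simp
  linarith

end LoeschianCount

section LoeschianEulerProduct

/-- The completely multiplicative function `n ↦ n ^ (-s)`. -/
noncomputable def natRpowNegHom {s : ℝ} (hs : s ≠ 0) : ℕ →*₀ ℝ where
  toFun n := (n : ℝ) ^ (-s)
  map_zero' := by rw [Nat.cast_zero, zero_rpow (neg_ne_zero.mpr hs)]
  map_one' := by rw [Nat.cast_one, one_rpow]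
  map_mul' m n := by rw [Nat.cast_mul, mul_rpow m.cast_nonneg n.cast_nonneg]

/-- The nontrivial Dirichlet character modulo three, with real values. -/
noncomputable def chiThree : ℕ →*₀ ℝ where
  toFun n := if n % 3 = 0 then 0 else if n % 3 = 1 then 1 else -1
  map_zero' := by simp
  map_one' := by simp
  map_mul' m n := by
    have hm : m % 3 < 3 := Nat.mod_lt _ (by norm_num)
    have hn : n % 3 < 3 := Nat.mod_lt _ (by norm_num)
    rw [Nat.mul_mod]
    interval_cases m % 3 <;> interval_cases n % 3 <;> norm_num

open Classical in
/-- The indicator function of the numbers all of whose prime factors are `2` modulo `3`. -/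
noncomputable def inertInd : ℕ →*₀ ℝ where
  toFun n := if n ≠ 0 ∧ ∀ p, p.Prime → p ∣ n → p % 3 = 2 then 1 else 0
  map_zero' := by simp
  map_one' := by
    refine if_pos ⟨one_ne_zero, fun p hp hd => absurd (Nat.dvd_one.mp hd) hp.one_lt.ne'⟩
  map_mul' m n := by
    have : (m * n ≠ 0 ∧ ∀ p, p.Prime → p ∣ m * n → p % 3 = 2) ↔
        (m ≠ 0 ∧ ∀ p, p.Prime → p ∣ m → p % 3 = 2) ∧
        (n ≠ 0 ∧ ∀ p, p.Prime → p ∣ n → p % 3 = 2) := by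
      rw [mul_ne_zero_iff]
      constructor
      · rintro ⟨⟨hm, hn⟩, h⟩
        exact ⟨⟨hm, fun p hp hd => h p hp (hd.mul_right n)⟩, hn, fun p hp hd => h p hp (hd.mul_left m)⟩
      · rintro ⟨⟨hm, h⟩, hn, h'⟩
        exact ⟨⟨hm, hn⟩, fun p hp hd => (hp.dvd_mul.mp hd).elim (h p hp) (h' p hp)⟩
    simp only [this, ite_and, mul_ite, mul_one, mul_zero]
    split_ifs <;> rfl

lemma abs_chiThree_le (n : ℕ) : |chiThree n| ≤ 1 := by
  change |if n % 3 = 0 then (0 : ℝ) else if n % 3 = 1 then 1 else -1| ≤ 1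
  split_ifs <;> simp

lemma inertInd_nonneg (n : ℕ) : 0 ≤ inertInd n := by
  classical
  change 0 ≤ if n ≠ 0 ∧ ∀ p, p.Prime → p ∣ n → p % 3 = 2 then (1 : ℝ) else 0
  split_ifs <;> simp

lemma inertInd_le_one (n : ℕ) : inertInd n ≤ 1 := by
  classical
  change (if n ≠ 0 ∧ ∀ p, p.Prime → p ∣ n → p % 3 = 2 then (1 : ℝ) else 0) ≤ 1
  split_ifs <;> simp

lemma abs_inertInd_le (n : ℕ) : |inertInd n| ≤ 1 := by
  rw [abs_of_nonneg (inertInd_nonneg n)]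
  exact inertInd_le_one n

lemma inertInd_apply_prime {p : ℕ} (hp : p.Prime) : inertInd p = if p % 3 = 2 then 1 else 0 := by
  classical
  change (if p ≠ 0 ∧ ∀ q, q.Prime → q ∣ p → q % 3 = 2 then (1 : ℝ) else 0) = _
  refine if_congr ⟨fun h => h.2 p hp dvd_rfl, fun h => ⟨hp.ne_zero, fun q hq hd => ?_⟩⟩ rfl rfl
  rwa [(Nat.prime_dvd_prime_iff_eq hq hp).mp hd]

lemma summable_mul_rpow_neg {f : ℕ → ℝ} (hf : ∀ n, |f n| ≤ 1) {s : ℝ} (hs : 1 < s) :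
    Summable fun n : ℕ => ‖f n * (n : ℝ) ^ (-s)‖ := by
  refine Summable.of_nonneg_of_le (fun n => norm_nonneg _) (fun n => ?_)
    (Real.summable_nat_rpow.mpr (neg_lt_neg hs))
  rw [norm_mul, norm_of_nonneg (rpow_nonneg n.cast_nonneg _)]
  exact mul_le_of_le_one_left (rpow_nonneg n.cast_nonneg _) (hf n)

lemma hasSum_ite_even_pow {x : ℝ} (h0 : 0 ≤ x) (h1 : x < 1) :
    HasSum (fun e : ℕ => if Even e then x ^ e else 0) (1 - x ^ 2)⁻¹ := by
  have hx : x ^ 2 < 1 := pow_lt_one₀ h0 h1 two_ne_zero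
  have h := hasSum_geometric_of_lt_one (sq_nonneg x) hx
  rw [← add_zero (1 - x ^ 2)⁻¹]
  refine HasSum.even_add_odd ?_ ?_
  · simpa [← pow_mul] using h
  · simp [hasSum_zero]

lemma loeschianInd_apply_prime_pow {p k : ℕ} (hp : p.Prime) :
    loeschianInd (p ^ k) = if p % 3 = 2 → Even k then 1 else 0 := by
  split_ifs with h
  · exact loeschianInd_apply_of_isLoeschian (pow_ne_zero _ hp.ne_zero)
      ((isLoeschian_prime_pow_iff hp).mpr h)
  · exact loeschianInd_apply_of_not_isLoeschian (mt (isLoeschian_prime_pow_iff hp).mp h)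

lemma loeschianInd_mul_of_coprime {m n : ℕ} (h : m.Coprime n) :
    loeschianInd (m * n) = loeschianInd m * loeschianInd n := by
  rcases eq_or_ne m 0 with rfl | hm
  · simp
  rcases eq_or_ne n 0 with rfl | hn
  · simp
  have := isLoeschian_mul_iff_of_coprime hm hn h
  by_cases h1 : IsLoeschian m
  · rw [loeschianInd_apply_of_isLoeschian hm h1, one_mul]
    exact loeschianInd_congr (mul_ne_zero hm hn) hn (by tauto)
  · rw [loeschianInd_apply_of_not_isLoeschian h1, zero_mul,
      loeschianInd_apply_of_not_isLoeschian (by tauto)]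

lemma tsum_loeschianInd_prime_pow {p : ℕ} (hp : p.Prime) {s : ℝ} (hs : 1 < s) :
    ∑' e, loeschianInd (p ^ e) * ((p ^ e : ℕ) : ℝ) ^ (-s) =
      if p % 3 = 2 then (1 - ((p : ℝ) ^ (-s)) ^ 2)⁻¹ else (1 - (p : ℝ) ^ (-s))⁻¹ := by
  have hp1 : (1 : ℝ) < p := by exact_mod_cast hp.one_lt
  have h0 : 0 ≤ (p : ℝ) ^ (-s) := rpow_nonneg p.cast_nonneg _
  have h1 : (p : ℝ) ^ (-s) < 1 := rpow_lt_one_of_one_lt_of_neg hp1 (by linarith)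
  have h2 : ∀ e : ℕ, ((p ^ e : ℕ) : ℝ) ^ (-s) = ((p : ℝ) ^ (-s)) ^ e := by
    intro e
    rw [Nat.cast_pow, ← rpow_natCast, ← rpow_mul p.cast_nonneg, mul_comm, rpow_mul p.cast_nonneg,
      rpow_natCast]
  simp only [h2, loeschianInd_apply_prime_pow hp]
  split_ifs with h
  · simpa [h] using (hasSum_ite_even_pow h0 h1).tsum_eq
  · simpa [h] using tsum_geometric_of_lt_one h0 h1

theorem sq_tsum_loeschianInd {s : ℝ} (hs : 1 < s) :
    (∑' n : ℕ, loeschianInd n * (n : ℝ) ^ (-s)) ^ 2 =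
      (∑' n : ℕ, (n : ℝ) ^ (-s)) * (∑' n : ℕ, chiThree n * (n : ℝ) ^ (-s)) *
      (1 - (3 : ℝ) ^ (-s))⁻¹ * ∑' n : ℕ, inertInd n * (n : ℝ) ^ (-(2 * s)) := by
  have hs0 : s ≠ 0 := by linarith
  have hb := EulerProduct.eulerProduct_hasProd (f := fun n => loeschianInd n * (n : ℝ) ^ (-s))
    (by
      have h1 : loeschianInd 1 = 1 := loeschianInd_apply_of_isLoeschian one_ne_zero (isLoeschian_sq 1)
      simp [h1])
    (by
      intro m n h
      rw [loeschianInd_mul_of_coprime h, Nat.cast_mul, mul_rpow m.cast_nonneg n.cast_nonneg]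
      ring)
    (summable_mul_rpow_neg (fun n => by
      rw [abs_of_nonneg (loeschianInd_nonneg n)]; exact loeschianInd_le_one n) hs) (by simp)
  have hz : HasProd (fun p : Nat.Primes => (1 - (p : ℝ) ^ (-s))⁻¹) (∑' n : ℕ, (n : ℝ) ^ (-s)) :=
    EulerProduct.eulerProduct_completely_multiplicative_hasProd (f := natRpowNegHom hs0)
      (by
        have := summable_mul_rpow_neg (f := fun _ => 1) (by simp) hs
        simp only [one_mul] at this
        exact this)
  have hl : HasProd (fun p : Nat.Primes => (1 - chiThree p * (p : ℝ) ^ (-s))⁻¹)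
      (∑' n : ℕ, chiThree n * (n : ℝ) ^ (-s)) :=
    EulerProduct.eulerProduct_completely_multiplicative_hasProd (f := chiThree * natRpowNegHom hs0)
      (summable_mul_rpow_neg abs_chiThree_le hs)
  have hw : HasProd (fun p : Nat.Primes => (1 - inertInd p * (p : ℝ) ^ (-(2 * s)))⁻¹)
      (∑' n : ℕ, inertInd n * (n : ℝ) ^ (-(2 * s))) :=
    EulerProduct.eulerProduct_completely_multiplicative_hasProd
      (f := inertInd * natRpowNegHom (by linarith : 2 * s ≠ 0))
      (summable_mul_rpow_neg abs_inertInd_le (by linarith))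
  have ht : HasProd (fun p : Nat.Primes => if (p : ℕ) = 3 then (1 - (p : ℝ) ^ (-s))⁻¹ else 1)
      (1 - (3 : ℝ) ^ (-s))⁻¹ := by
    have := hasProd_single (L := SummationFilter.unconditional Nat.Primes)
      (f := fun p : Nat.Primes => if (p : ℕ) = 3 then (1 - (p : ℝ) ^ (-s))⁻¹ else 1)
      ⟨3, Nat.prime_three⟩ (fun p hp => if_neg fun h => hp (Subtype.ext h))
    simpa using this
  rw [sq]
  refine (hb.mul hb).unique ?_
  refine HasProd.congr_fun (((hz.mul hl).mul ht).mul hw) ?_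
  rintro ⟨p, hp⟩
  have hp1 : (1 : ℝ) < p := by exact_mod_cast hp.one_lt
  have h0 : 0 < (p : ℝ) ^ (-s) := rpow_pos_of_pos (by linarith) _
  have h1 : (p : ℝ) ^ (-s) < 1 := rpow_lt_one_of_one_lt_of_neg hp1 (by linarith)
  have h2 : (p : ℝ) ^ (-(2 * s)) = ((p : ℝ) ^ (-s)) ^ 2 := by
    rw [← rpow_natCast, ← rpow_mul (by linarith)]; congr 1; push_cast; ring
  have hchi : chiThree p = if p % 3 = 0 then 0 else if p % 3 = 1 then 1 else -1 := rfl
  dsimp only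
  rw [tsum_loeschianInd_prime_pow hp hs, inertInd_apply_prime hp, h2, hchi]
  generalize (p : ℝ) ^ (-s) = x at h0 h1
  rcases (by omega : p % 3 = 0 ∨ p % 3 = 1 ∨ p % 3 = 2) with h | h | h
  · have hp3 : 3 = p := (Nat.prime_dvd_prime_iff_eq Nat.prime_three hp).mp (Nat.dvd_of_mod_eq_zero h)
    subst hp3
    simp
  · have hp3 : p ≠ 3 := by omega
    simp [h, hp3]
  · have hp3 : p ≠ 3 := by omega
    simp only [h, hp3, if_true, if_false, one_mul, mul_one]
    norm_num
    left
    rw [← mul_inv]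
    ring_nf

end LoeschianEulerProduct

section LoeschianSingularity

lemma tsum_chiThree_eq {s : ℝ} (hs : 1 < s) :
    ∑' n : ℕ, chiThree n * (n : ℝ) ^ (-s) =
      1 + ∑' m : ℕ, ((3 * m + 4 : ℝ) ^ (-s) - (3 * m + 2 : ℝ) ^ (-s)) := by
  have hsum := (summable_mul_rpow_neg abs_chiThree_le hs).of_norm
  have hchi : ∀ n, chiThree n = if n % 3 = 0 then 0 else if n % 3 = 1 then 1 else -1 := fun n => rfl
  have hS : Summable fun n : ℕ => (n : ℝ) ^ (-s) := Real.summable_nat_rpow.mpr (neg_lt_neg hs)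
  have hinj : ∀ j : ℕ, Function.Injective fun m : ℕ => 3 * m + j := fun j a b h => by
    simpa using h
  have h1 := (hS.comp_injective (hinj 1))
  have h2 := (hS.comp_injective (hinj 2))
  have h4 := (hS.comp_injective (hinj 4))
  rw [Nat.sumByResidueClasses hsum 3, show (Finset.univ : Finset (ZMod 3)) = {0, 1, 2} from rfl,
    Finset.sum_insert (by decide), Finset.sum_insert (by decide), Finset.sum_singleton]
  have e0 : ∀ m : ℕ, chiThree ((0 : ZMod 3).val + 3 * m) = 0 := fun m => by
    rw [hchi, if_pos (by rw [ZMod.val_zero]; omega)]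
  have v1 : (1 : ZMod 3).val = 1 := rfl
  have v2 : (2 : ZMod 3).val = 2 := rfl
  have e1 : ∀ m : ℕ, chiThree (1 + 3 * m) = 1 := fun m => by
    rw [hchi, if_neg (by omega), if_pos (by omega)]
  have e2 : ∀ m : ℕ, chiThree (2 + 3 * m) = -1 := fun m => by
    rw [hchi, if_neg (by omega), if_neg (by omega)]
  simp only [e0, e1, e2, zero_mul, tsum_zero, zero_add, one_mul, neg_one_mul, tsum_neg, v1, v2]
  have g1 : ∑' m : ℕ, ((1 + 3 * m : ℕ) : ℝ) ^ (-s) = 1 + ∑' m : ℕ, (3 * m + 4 : ℝ) ^ (-s) := by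
    have : Summable fun m : ℕ => ((1 + 3 * m : ℕ) : ℝ) ^ (-s) := by
      simpa [Function.comp_def, add_comm] using h1
    rw [this.tsum_eq_zero_add]
    simp only [mul_zero, add_zero, Nat.cast_one, one_rpow]
    congr 2; funext m
    congr 1; push_cast; ring
  have g2 : ∑' m : ℕ, ((2 + 3 * m : ℕ) : ℝ) ^ (-s) = ∑' m : ℕ, (3 * m + 2 : ℝ) ^ (-s) := by
    congr 1; funext m
    congr 1; push_cast; ring
  rw [g1, g2, Summable.tsum_sub (by simpa [Function.comp_def] using h4)
    (by simpa [Function.comp_def] using h2)]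
  ring

lemma abs_rpow_neg_sub_rpow_neg_le {a s : ℝ} (ha : 1 ≤ a) (hs : 1 ≤ s) (hs2 : s ≤ 2) :
    |(a + 2) ^ (-s) - a ^ (-s)| ≤ 4 * (a ^ 2)⁻¹ := by
  have ha0 : 0 < a := by linarith
  have h1 : (a + 2) ^ (-s) ≤ a ^ (-s) :=
    rpow_le_rpow_of_nonpos ha0 (by linarith) (by linarith)
  have h2 : 1 + s * (-2 / (a + 2)) ≤ (1 + -2 / (a + 2)) ^ s :=
    one_add_mul_self_le_rpow_one_add (by rw [le_div_iff₀ (by linarith)]; linarith) hs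
  have h3 : 1 + -2 / (a + 2) = a / (a + 2) := by field_simp; ring
  have h4 : (a + 2) ^ (-s) = a ^ (-s) * (a / (a + 2)) ^ s := by
    rw [div_rpow ha0.le (by linarith), rpow_neg ha0.le, rpow_neg (by linarith)]
    have := (rpow_pos_of_pos ha0 s).ne'
    field_simp
  have h5 : a ^ (-s) ≤ a⁻¹ := by
    rw [← rpow_neg_one]
    exact rpow_le_rpow_of_exponent_le ha (by linarith)
  rw [abs_of_nonpos (by linarith), h4]
  rw [h3] at h2
  have h6 : 1 - (a / (a + 2)) ^ s ≤ 4 * a⁻¹ := by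
    have : s * (2 / (a + 2)) ≤ 2 * (2 / a) := by gcongr; linarith
    have e : s * (-2 / (a + 2)) = -(s * (2 / (a + 2))) := by ring
    have e' : 2 * (2 / a) = 4 * a⁻¹ := by ring
    linarith
  have h7 : 0 ≤ a ^ (-s) := rpow_nonneg ha0.le _
  calc -(a ^ (-s) * (a / (a + 2)) ^ s - a ^ (-s)) = a ^ (-s) * (1 - (a / (a + 2)) ^ s) := by ring
    _ ≤ a ^ (-s) * (4 * a⁻¹) := by gcongr
    _ ≤ a⁻¹ * (4 * a⁻¹) := by gcongr
    _ = 4 * (a ^ 2)⁻¹ := by rw [sq, mul_inv]; ring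

lemma summable_inv_three_mul_add_two_sq : Summable fun m : ℕ => 4 * ((3 * m + 2 : ℝ) ^ 2)⁻¹ := by
  have h : Summable fun n : ℕ => ((n : ℝ) ^ 2)⁻¹ := Real.summable_nat_pow_inv.mpr one_lt_two
  have hinj : Function.Injective fun m : ℕ => 3 * m + 2 := fun a b h => by simpa using h
  have := (h.comp_injective hinj).mul_left 4
  simpa [Function.comp_def] using this

lemma one_add_tsum_eq_pi_div :
    1 + ∑' m : ℕ, ((3 * m + 4 : ℝ) ^ (-(1 : ℝ)) - (3 * m + 2 : ℝ) ^ (-(1 : ℝ))) =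
      π / (3 * √3) := by
  have hmem : (1 / 3 : ℂ) ∈ Complex.integerComplement := by
    rintro ⟨n, hn⟩
    have h1 : (3 * n : ℂ) = 1 := by rw [hn]; norm_num
    have h2 : 3 * n = 1 := by exact_mod_cast h1
    omega
  have h := cot_series_rep' hmem
  have hcot : Complex.cot (π * (1 / 3)) = ((√3)⁻¹ : ℝ) := by
    have : (π * (1 / 3) : ℂ) = ((π / 3 : ℝ) : ℂ) := by push_cast; ring
    rw [this, ← Complex.ofReal_cot, Real.cot_eq_cos_div_sin, cos_pi_div_three, sin_pi_div_three]
    congr 1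
    field_simp
  rw [hcot] at h
  have h2 : ∀ n : ℕ, (1 / ((1 / 3 : ℂ) - (n + 1)) + 1 / (1 / 3 + (n + 1))) =
      ((3 * ((3 * n + 4 : ℝ) ^ (-(1 : ℝ)) - (3 * n + 2 : ℝ) ^ (-(1 : ℝ))) : ℝ) : ℂ) := by
    intro n
    rw [rpow_neg_one, rpow_neg_one]
    have e1 : (1 / 3 : ℂ) - (n + 1) = -((3 * n + 2 : ℝ) : ℂ) / 3 := by push_cast; ring
    have e2 : (1 / 3 : ℂ) + (n + 1) = ((3 * n + 4 : ℝ) : ℂ) / 3 := by push_cast; ring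
    rw [e1, e2, Complex.ofReal_mul, Complex.ofReal_sub, Complex.ofReal_inv, Complex.ofReal_inv]
    push_cast
    rw [one_div_div, one_div_div, div_neg]
    ring
  simp only [h2] at h
  rw [← Complex.ofReal_tsum, tsum_mul_left] at h
  have h3 : π * (√3)⁻¹ - 3 = 3 * ∑' m : ℕ,
      ((3 * m + 4 : ℝ) ^ (-(1 : ℝ)) - (3 * m + 2 : ℝ) ^ (-(1 : ℝ))) := by
    have e : (π * ((√3)⁻¹ : ℝ) - 1 / (1 / 3) : ℂ) = ((π * (√3)⁻¹ - 3 : ℝ) : ℂ) := by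
      push_cast; norm_num
    rw [e] at h
    exact_mod_cast h
  have h4 : π / (3 * √3) = π * (√3)⁻¹ / 3 := by
    rw [div_eq_mul_inv, mul_inv]; ring
  rw [h4]
  linarith

lemma tendsto_tsum_chiThree :
    Tendsto (fun s : ℝ => ∑' n : ℕ, chiThree n * (n : ℝ) ^ (-s)) (𝓝[>] 1) (𝓝 (π / (3 * √3))) := by
  have h : Tendsto (fun s : ℝ => 1 + ∑' m : ℕ, ((3 * m + 4 : ℝ) ^ (-s) - (3 * m + 2 : ℝ) ^ (-s)))
      (𝓝[>] 1) (𝓝 (π / (3 * √3))) := by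
    rw [← one_add_tsum_eq_pi_div]
    refine tendsto_const_nhds.add
      (tendsto_tsum_of_dominated_convergence summable_inv_three_mul_add_two_sq (fun m => ?_) ?_)
    · refine Tendsto.mono_left ?_ nhdsWithin_le_nhds
      have : ∀ a : ℝ, 0 < a → Tendsto (fun s : ℝ => a ^ (-s)) (𝓝 1) (𝓝 (a ^ (-(1 : ℝ)))) :=
        fun a ha => ((continuous_const_rpow ha.ne').comp continuous_neg).tendsto 1
      exact (this _ (by positivity)).sub (this _ (by positivity))
    · have h2 : ∀ᶠ s in 𝓝[>] (1 : ℝ), s ≤ 2 :=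
        (eventually_le_nhds one_lt_two).filter_mono nhdsWithin_le_nhds
      filter_upwards [h2, self_mem_nhdsWithin] with s hs2 hs1 m
      have := abs_rpow_neg_sub_rpow_neg_le (a := 3 * m + 2) (s := s)
        (by have : (0 : ℝ) ≤ m := m.cast_nonneg
            linarith) (le_of_lt hs1) hs2
      rwa [show (3 * m + 2 + 2 : ℝ) = 3 * m + 4 by ring] at this
  refine h.congr' ?_
  filter_upwards [self_mem_nhdsWithin] with s hs
  exact (tsum_chiThree_eq hs).symm

lemma tendsto_tsum_inertInd :
    Tendsto (fun s : ℝ => ∑' n : ℕ, inertInd n * (n : ℝ) ^ (-(2 * s))) (𝓝[>] 1)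
      (𝓝 (∑' n : ℕ, inertInd n * (n : ℝ) ^ (-(2 : ℝ)))) := by
  refine tendsto_tsum_of_dominated_convergence
    (bound := fun n : ℕ => (n : ℝ) ^ (-(2 : ℝ)))
    (Real.summable_nat_rpow.mpr (by norm_num)) (fun n => ?_) ?_
  · rcases eq_or_ne n 0 with rfl | hn
    · simp
    have hn' : (n : ℝ) ≠ 0 := by exact_mod_cast hn
    refine Tendsto.mono_left ?_ nhdsWithin_le_nhds
    have : Continuous fun s : ℝ => inertInd n * (n : ℝ) ^ (-(2 * s)) :=
      continuous_const.mul ((continuous_const_rpow hn').comp (by fun_prop))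
    simpa using this.tendsto 1
  · filter_upwards [self_mem_nhdsWithin] with s hs n
    have hs' : 1 < s := hs
    rcases eq_or_ne n 0 with rfl | hn
    · simp
    rw [norm_mul, norm_of_nonneg (rpow_nonneg n.cast_nonneg _)]
    refine (mul_le_of_le_one_left (rpow_nonneg n.cast_nonneg _) (abs_inertInd_le n)).trans ?_
    exact rpow_le_rpow_of_exponent_le (by exact_mod_cast Nat.one_le_iff_ne_zero.mpr hn) (by linarith)

theorem tendsto_sqrt_mul_tsum_loeschianInd :
    Tendsto (fun s : ℝ => √(s - 1) * ∑' n : ℕ, loeschianInd n * (n : ℝ) ^ (-s)) (𝓝[>] 1)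
      (𝓝 √(π / (2 * √3) * ∑' n : ℕ, inertInd n * (n : ℝ) ^ (-(2 : ℝ)))) := by
  have h1 := tendsto_sub_mul_tsum_nat_rpow
  have h2 : Tendsto (fun s : ℝ => (1 - (3 : ℝ) ^ (-s))⁻¹) (𝓝[>] 1) (𝓝 (3 / 2)) := by
    have : Tendsto (fun s : ℝ => (3 : ℝ) ^ (-s)) (𝓝 1) (𝓝 (3 ^ (-(1 : ℝ)))) :=
      ((continuous_const_rpow three_ne_zero).comp continuous_neg).tendsto 1
    have := (this.const_sub 1).inv₀ (by rw [rpow_neg_one]; norm_num)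
    rw [rpow_neg_one, show (1 - (3 : ℝ)⁻¹)⁻¹ = 3 / 2 by norm_num] at this
    exact this.mono_left nhdsWithin_le_nhds
  have h3 := (((h1.mul tendsto_tsum_chiThree).mul h2).mul tendsto_tsum_inertInd).sqrt
  have e : 1 * (π / (3 * √3)) * (3 / 2) = π / (2 * √3) := by
    have : √3 ≠ 0 := by positivity
    field_simp
  rw [e] at h3
  refine h3.congr' ?_
  filter_upwards [self_mem_nhdsWithin] with s hs
  have hs' : 1 < s := hs
  have hF : 0 ≤ ∑' n : ℕ, loeschianInd n * (n : ℝ) ^ (-s) :=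
    tsum_nonneg fun n => mul_nonneg (loeschianInd_nonneg n) (rpow_nonneg n.cast_nonneg _)
  have hz : ∑' n : ℕ, 1 / (n : ℝ) ^ s = ∑' n : ℕ, (n : ℝ) ^ (-s) := by
    congr 1; funext n
    rw [rpow_neg n.cast_nonneg, one_div]
  have e2 : (s - 1) * (∑' n : ℕ, 1 / (n : ℝ) ^ s) * (∑' n : ℕ, chiThree n * (n : ℝ) ^ (-s)) *
      (1 - (3 : ℝ) ^ (-s))⁻¹ * (∑' n : ℕ, inertInd n * (n : ℝ) ^ (-(2 * s))) =
      (s - 1) * (∑' n : ℕ, loeschianInd n * (n : ℝ) ^ (-s)) ^ 2 := by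
    rw [sq_tsum_loeschianInd hs', hz]; ring
  rw [e2, sqrt_mul (by linarith), sqrt_sq hF]

end LoeschianSingularity

section LoeschianAsymptotics

lemma tendsto_loeschianRecip :
    Tendsto (fun x => loeschianRecip x / √(log x)) atTop
      (𝓝 (√(π / (2 * √3) * ∑' n : ℕ, inertInd n * (n : ℝ) ^ (-(2 : ℝ))) / Gamma (1 / 2 + 1))) := by
  have hexp : ∀ (σ : ℝ) (m : ℕ), 0 < σ → loeschianInd m / m * exp (-(σ * log m)) =
      loeschianInd m * (m : ℝ) ^ (-(1 + σ)) := by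
    intro σ m hσ
    rcases eq_or_ne m 0 with rfl | hm
    · simp
    have hm0 : (0 : ℝ) < m := by exact_mod_cast Nat.pos_of_ne_zero hm
    rw [neg_add, rpow_add hm0, rpow_neg_one, rpow_def_of_pos hm0, div_eq_mul_inv, mul_assoc,
      mul_neg, mul_comm σ]
  have hshift : Tendsto (fun σ : ℝ => 1 + σ) (𝓝[>] 0) (𝓝[>] 1) := by
    refine tendsto_nhdsWithin_iff.mpr ⟨?_, ?_⟩
    · have : Tendsto (fun σ : ℝ => 1 + σ) (𝓝 0) (𝓝 (1 + 0)) := Continuous.tendsto (by fun_prop) 0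
      rw [add_zero] at this
      exact this.mono_left nhdsWithin_le_nhds
    · filter_upwards [self_mem_nhdsWithin] with σ hσ
      exact Set.mem_Ioi.mpr (lt_add_of_pos_right 1 (Set.mem_Ioi.mp hσ))
  have hK := tendsto_karamata (c := fun m => loeschianInd m / m) (d := fun m : ℕ => log m)
    (r := 1 / 2) one_half_pos
    (fun m => div_nonneg (loeschianInd_nonneg m) m.cast_nonneg) (fun m => log_natCast_nonneg m)
    (fun σ hσ => by
      simp only [hexp σ _ hσ]
      exact (summable_mul_rpow_neg (fun n => by
        rw [abs_of_nonneg (loeschianInd_nonneg n)]; exact loeschianInd_le_one n)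
        (lt_add_of_pos_right 1 hσ)).of_norm)
    (by
      refine (tendsto_sqrt_mul_tsum_loeschianInd.comp hshift).congr' ?_
      filter_upwards [self_mem_nhdsWithin] with σ hσ
      simp only [Function.comp, hexp σ _ hσ, add_sub_cancel_left, sqrt_eq_rpow])
  have hlog : Tendsto (fun x : ℝ => (log x)⁻¹) atTop (𝓝[>] 0) :=
    tendsto_inv_atTop_nhdsGT_zero.comp tendsto_log_atTop
  refine (hK.comp hlog).congr' ?_
  filter_upwards [eventually_gt_atTop 1] with x hx
  have hL : 0 < log x := log_pos hx
  have hx0 : 0 < x := by linarith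
  simp only [Function.comp]
  rw [← sqrt_eq_rpow, sqrt_inv, inv_mul_eq_div, loeschianRecip,
    tsum_eq_sum (s := Finset.Ioc 0 ⌊x⌋₊)]
  · congr 1
    refine Finset.sum_congr rfl fun m hm => if_pos ?_
    obtain ⟨hm0, hm1⟩ := Finset.mem_Ioc.mp hm
    rw [inv_mul_eq_div, div_le_one hL]
    exact log_le_log (by exact_mod_cast hm0) ((Nat.le_floor_iff hx0.le).mp hm1)
  · intro m hm
    rcases eq_or_ne m 0 with rfl | hm0
    · simp
    refine if_neg fun h => hm (Finset.mem_Ioc.mpr ⟨Nat.pos_of_ne_zero hm0, ?_⟩)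
    rw [inv_mul_eq_div, div_le_one hL, log_le_log_iff (by exact_mod_cast Nat.pos_of_ne_zero hm0) hx0]
      at h
    exact Nat.le_floor h

lemma tprod_inert_rpow_neg_half :
    ∏' p : {p : ℕ // p.Prime ∧ p % 3 = 2}, (1 - (p.1 : ℝ) ^ (-(2 : ℝ))) ^ (-(1 : ℝ) / 2) =
      √(∑' n : ℕ, inertInd n * (n : ℝ) ^ (-(2 : ℝ))) := by
  have hw : HasProd (fun p : Nat.Primes => (1 - inertInd p * (p : ℝ) ^ (-(2 : ℝ)))⁻¹)
      (∑' n : ℕ, inertInd n * (n : ℝ) ^ (-(2 : ℝ))) :=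
    EulerProduct.eulerProduct_completely_multiplicative_hasProd
      (f := inertInd * natRpowNegHom two_ne_zero)
      (summable_mul_rpow_neg abs_inertInd_le one_lt_two)
  have hnn : ∀ p : Nat.Primes, 0 ≤ 1 - (p : ℝ) ^ (-(2 : ℝ)) := fun p =>
    sub_nonneg.mpr (rpow_le_one_of_one_le_of_nonpos (by exact_mod_cast p.2.one_lt.le) (by norm_num))
  set f : ℕ → ℝ := fun p => (1 - (p : ℝ) ^ (-(2 : ℝ))) ^ (-(1 : ℝ) / 2) with hf
  have hs : HasProd (fun p : Nat.Primes => {p : ℕ | p % 3 = 2}.mulIndicator f p)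
      √(∑' n : ℕ, inertInd n * (n : ℝ) ^ (-(2 : ℝ))) := by
    have : ∀ p : Nat.Primes, {p : ℕ | p % 3 = 2}.mulIndicator f p =
        ((1 - inertInd p * (p : ℝ) ^ (-(2 : ℝ)))⁻¹) ^ (1 / 2 : ℝ) := by
      intro p
      by_cases h : (p : ℕ) % 3 = 2
      · rw [Set.mulIndicator_of_mem (show (p : ℕ) ∈ {p : ℕ | p % 3 = 2} from h),
          inertInd_apply_prime p.2, if_pos h, one_mul, inv_rpow (hnn p), ← rpow_neg (hnn p), hf,
          neg_div]
      · rw [Set.mulIndicator_of_notMem (show (p : ℕ) ∉ {p : ℕ | p % 3 = 2} from h),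
          inertInd_apply_prime p.2, if_neg h]
        simp
    have hpos : ∀ p : Nat.Primes, 0 ≤ (1 - inertInd p * (p : ℝ) ^ (-(2 : ℝ)))⁻¹ := by
      intro p
      rw [inertInd_apply_prime p.2]
      split_ifs
      · rw [one_mul]; exact inv_nonneg.mpr (hnn p)
      · simp
    unfold HasProd at hw ⊢
    refine hw.sqrt.congr fun s => ?_
    simp only [this]
    rw [sqrt_eq_rpow, Real.finsetProd_rpow _ _ fun p _ => hpos p]
  have hs' : HasProd (f ∘ ((↑) : {p : ℕ | p.Prime ∧ p % 3 = 2} → ℕ))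
      √(∑' n : ℕ, inertInd n * (n : ℝ) ^ (-(2 : ℝ))) := by
    rw [hasProd_subtype_iff_mulIndicator]
    have h := (hasProd_subtype_iff_mulIndicator (s := {p : ℕ | p.Prime})
      (f := {p : ℕ | p % 3 = 2}.mulIndicator f)).mp hs
    rwa [Set.mulIndicator_mulIndicator] at h
  exact hs'.tprod_eq

lemma ncard_isLoeschian_le (x : ℝ) :
    (Set.ncard {n : ℕ | 0 < n ∧ (n : ℝ) ≤ x ∧ ∃ a b : ℤ, (n : ℤ) = a ^ 2 + a * b + b ^ 2} : ℝ) =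
      loeschianCount x := by
  classical
  have h : {n : ℕ | 0 < n ∧ (n : ℝ) ≤ x ∧ ∃ a b : ℤ, (n : ℤ) = a ^ 2 + a * b + b ^ 2} =
      ((Finset.Ioc 0 ⌊x⌋₊).filter fun n => n ≠ 0 ∧ IsLoeschian n : Finset ℕ) := by
    ext n
    simp only [Set.mem_ofPred_eq, Finset.coe_filter, Finset.mem_Ioc]
    constructor
    · rintro ⟨h0, h1, h2⟩
      exact ⟨⟨h0, Nat.le_floor h1⟩, h0.ne', h2⟩
    · rintro ⟨⟨h0, h1⟩, -, h2⟩
      exact ⟨h0, (Nat.le_floor_iff' h0.ne').mp h1, h2⟩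
  rw [h, Set.ncard_coe_finset, loeschianCount, Finset.card_filter, Nat.cast_sum]
  refine Finset.sum_congr rfl fun n _ => ?_
  rw [Nat.cast_ite, Nat.cast_one, Nat.cast_zero]
  exact if_congr Iff.rfl rfl rfl

end LoeschianAsymptotics

theorem stmt3 :
    Tendsto (fun x : ℝ =>
        (Set.ncard {n : ℕ | 0 < n ∧ (n : ℝ) ≤ x ∧
          ∃ a b : ℤ, (n : ℤ) = a ^ 2 + a * b + b ^ 2} : ℝ) * Real.sqrt (Real.log x) / x)
      atTop
      (nhds (2 ^ (-(1 : ℝ) / 2) * 3 ^ (-(1 : ℝ) / 4) *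
        ∏' p : {p : ℕ // p.Prime ∧ p % 3 = 2}, (1 - (p.1 : ℝ) ^ (-(2 : ℝ))) ^ (-(1 : ℝ) / 2))) := by
  simp only [ncard_isLoeschian_le]
  rw [tprod_inert_rpow_neg_half]
  convert tendsto_loeschianCount_of_loeschianRecip tendsto_loeschianRecip using 2
  have h2 : (2 : ℝ) ^ (-(1 : ℝ) / 2) = (√2)⁻¹ := by
    rw [neg_div, rpow_neg zero_le_two, sqrt_eq_rpow]
  have h3 : (3 : ℝ) ^ (-(1 : ℝ) / 4) = (√(√3))⁻¹ := by
    rw [neg_div, rpow_neg zero_le_three, sqrt_eq_rpow, sqrt_eq_rpow, ← rpow_mul zero_le_three]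
    norm_num
  rw [h2, h3, Gamma_add_one one_half_pos.ne', Gamma_one_half_eq, sqrt_mul (by positivity),
    sqrt_div pi_pos.le, sqrt_mul zero_le_two]
  have hpi : √π ≠ 0 := (sqrt_pos.mpr pi_pos).ne'
  field_simp
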